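/- arXiv:1604.02317 — 2 statements merged into one kernel-verified Lean document; each statement's English description precedes it below -/
import Mathlib

section
/- Let (G,s_1,t_1,…,s_k,t_k) be a problem instance and let L=(P_1,…,P_k) be a minimum linkage for (G,s_1,t_1,…,s_k,t_k). Let C be a clique of G, and suppose that B⊆V(L) is C-acceptable for L and B≠(V(L)∩C)∖{t_1,…,t_k}. Then there exists v∈(V(L)∩C)∖(B∪{t_1,…,t_k}) such that B∪{v} is C-acceptable for L. -/
open scoped Classical

noncomputable section

/-- A digraph: loopless, no parallel edges (an adjacency relation);
for distinct `u v` both `adj u v` and `adj v u` may hold. -/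
structure Dgraph (V : Type) where
  adj : V → V → Prop
  irrefl : ∀ v, ¬ adj v v

/-- A directed path in a digraph `G`, given by its (nonempty, duplicate-free) list of
vertices, consecutive vertices being adjacent. -/
structure Dpath {V : Type} (G : Dgraph V) where
  verts : List V
  ne : verts ≠ []
  nodup : verts.Nodup
  chain : verts.Chain' G.adj

namespace Dpath

variable {V : Type} {G : Dgraph V}

/-- `s(P)`, the first vertex of a path. -/
def first (P : Dpath G) : V := P.verts.head P.ne

/-- `t(P)`, the last vertex of a path. -/
def last (P : Dpath G) : V := P.verts.getLast P.ne

/-- `V(P)`, the set of vertices of a path. -/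
def support (P : Dpath G) : Set V := {v | v ∈ P.verts}

/-- The length of a path: its number of edges. -/
def length (P : Dpath G) : ℕ := P.verts.length - 1

/-- `Q` is a subpath of `P`. -/
def IsSubpath (Q P : Dpath G) : Prop := Q.verts <:+: P.verts

/-- `Q` is an initial subpath of `P` (a subpath with `s(Q) = s(P)`). -/
def IsInitialSubpath (Q P : Dpath G) : Prop := Q.verts <+: P.verts

/-- The (directed) edges of a path, as ordered pairs of consecutive vertices. -/
def edges (P : Dpath G) : List (V × V) := P.verts.zip P.verts.tail

end Dpath

variable {V : Type}

/-- A family of paths is a linkage when its members are pairwise vertex-disjoint. -/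
def IsLinkage {G : Dgraph V} {k : ℕ} (L : Fin k → Dpath G) : Prop :=
  ∀ i j, i ≠ j → Disjoint (L i).support (L j).support

/-- `V(L)`, the union of the vertex sets of the members of a linkage. -/
def linkSupport {G : Dgraph V} {k : ℕ} (L : Fin k → Dpath G) : Set V :=
  ⋃ i, (L i).support

/-- `(G, s 1, t 1, …, s k, t k)` is a problem instance: the `2k` vertices are distinct. -/
def IsInstance {k : ℕ} (sv tv : Fin k → V) : Prop :=
  Function.Injective sv ∧ Function.Injective tv ∧ ∀ i j, sv i ≠ tv j

/-- `L` is a linkage for the problem instance: its `i`-th member runs from `s i` to `t i`. -/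
def IsLinkageFor {G : Dgraph V} {k : ℕ} (L : Fin k → Dpath G) (sv tv : Fin k → V) : Prop :=
  IsLinkage L ∧ ∀ i, (L i).first = sv i ∧ (L i).last = tv i

/-- A linkage is minimum if no linkage joining the same pairs of ends uses fewer vertices. -/
def IsMinimumLinkage {G : Dgraph V} {k : ℕ} (L : Fin k → Dpath G) : Prop :=
  IsLinkage L ∧ ∀ L' : Fin k → Dpath G, IsLinkage L' →
    (∀ i, (L' i).first = (L i).first ∧ (L' i).last = (L i).last) →
    (linkSupport L).ncard ≤ (linkSupport L').ncard

/-- A minimum linkage for a problem instance. -/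
def IsMinimumLinkageFor {G : Dgraph V} {k : ℕ} (L : Fin k → Dpath G)
    (sv tv : Fin k → V) : Prop :=
  IsLinkageFor L sv tv ∧ IsMinimumLinkage L

/-- `C ⊆ V(G)` is a clique if `G[C]` is semicomplete. -/
def Dgraph.IsClique (G : Dgraph V) (C : Set V) : Prop :=
  ∀ u ∈ C, ∀ v ∈ C, u ≠ v → (G.adj u v ∨ G.adj v u)

/-- `(C 1, …, C c)` is a clique-partition of `G`: a partition of `V(G)` into
(possibly empty) cliques. -/
def Dgraph.IsCliquePartition (G : Dgraph V) {c : ℕ} (C : Fin c → Set V) : Prop :=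
  (∀ a, G.IsClique (C a)) ∧ ∀ v : V, ∃! a, v ∈ C a

/-- The internal vertices of a linkage: vertices of `V(L)` not an end of any member. -/
def internalVerts {G : Dgraph V} {k : ℕ} (L : Fin k → Dpath G) : Set V :=
  linkSupport L \ ((Set.range fun i => (L i).first) ∪ (Set.range fun i => (L i).last))

/-- `M` is internally disjoint from `L`: no internal vertex of `M` belongs to `V(L)`. -/
def InternallyDisjointFrom {G : Dgraph V} {m k : ℕ} (M : Fin m → Dpath G)
    (L : Fin k → Dpath G) : Prop :=
  ∀ v ∈ internalVerts M, v ∉ linkSupport L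

/-- A planar `(Q,R)`-matching of cardinality `n`: a linkage of `n` paths, each with at most
three vertices, whose first vertices lie on `Q` in order and last vertices lie on `R` in
order. -/
def IsPlanarMatching {G : Dgraph V} {n : ℕ} (Q R : Dpath G) (M : Fin n → Dpath G) : Prop :=
  IsLinkage M ∧ (∀ j, (M j).verts.length ≤ 3) ∧
  (List.ofFn fun j => (M j).first).Sublist Q.verts ∧
  (List.ofFn fun j => (M j).last).Sublist R.verts

/-- A planar `(Q,R)`-matching from `X` to `Y`. -/
def IsPlanarMatchingFromTo {G : Dgraph V} {n : ℕ} (Q R : Dpath G) (M : Fin n → Dpath G)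
    (X Y : Set V) : Prop :=
  IsPlanarMatching Q R M ∧ ∀ j, (M j).first ∈ X ∧ (M j).last ∈ Y

/-- `B ⊆ C` is `C`-acceptable for the linkage `L` (for the instance given by `sv, tv`). -/
def CAcceptable {G : Dgraph V} {k : ℕ} (sv tv : Fin k → V) (L : Fin k → Dpath G)
    (C B : Set V) : Prop :=
  B ⊆ C ∧
  Set.range sv ∩ C ⊆ B ∧
  Set.range tv ∩ B = ∅ ∧
  (∀ i, ∃ Q : Dpath G, Q.IsInitialSubpath (L i) ∧ Q.support ∩ C = (L i).support ∩ B) ∧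
  ∀ i j : Fin k, ¬ ∃ M : Fin (k ^ 2 + k + 2) → Dpath G,
      IsPlanarMatchingFromTo (L i) (L j) M B (C \ B) ∧ InternallyDisjointFrom M L

/-- A list of vertices is `(X,Y)`-alternating: entries with even position (0-based) are
in `X`, those with odd position in `Y`. -/
def Alternating (X Y : Set V) (l : List V) : Prop :=
  ∀ (i : ℕ) (h : i < l.length),
    if i % 2 = 0 then l.get ⟨i, h⟩ ∈ X else l.get ⟨i, h⟩ ∈ Y

/-- `P` contains an `(X,Y)`-alternating sequence (of distinct vertices, in order in `P`)
of length `2 * m`. -/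
def HasAlt {G : Dgraph V} (P : Dpath G) (X Y : Set V) (m : ℕ) : Prop :=
  ∃ l : List V, l.Sublist P.verts ∧ l.length = 2 * m ∧ Alternating X Y l

/-- The `(X,Y)`-wiggle number of `P`: half the length of the longest `(X,Y)`-alternating
sequence of vertices in order in `P`. -/
def wiggle {G : Dgraph V} (P : Dpath G) (X Y : Set V) : ℕ :=
  sSup {m | HasAlt P X Y m}

/-- `zOf k c = c(c(k²+k+1)+k+2)`. -/
def zOf (k c : ℕ) : ℕ := c * (c * (k ^ 2 + k + 1) + k + 2)

/-- `wOf k c = c(c−1)(z+1)+1`. -/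
def wOf (k c : ℕ) : ℕ := c * (c - 1) * (zOf k c + 1) + 1

/-- `rOf k c = ckw`. -/
def rOf (k c : ℕ) : ℕ := c * k * wOf k c

/-- `sOf k = k²+k+3`. -/
def sOf (k : ℕ) : ℕ := k ^ 2 + k + 3

/-- `tOf k c = 2cskw + c(2w+1)k²(k²+k+1)`. -/
def tOf (k c : ℕ) : ℕ :=
  2 * c * sOf k * k * wOf k c + c * (2 * wOf k c + 1) * k ^ 2 * (k ^ 2 + k + 1)

/-- Given a clique-partition `C` and a linkage `L` for the instance, `B` is acceptable
(with `A = V(G) ∖ B`). -/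
def Acceptable {G : Dgraph V} {k c : ℕ} (sv tv : Fin k → V) (L : Fin k → Dpath G)
    (C : Fin c → Set V) (z : ℕ) (B : Set V) : Prop :=
  (∀ i, sv i ∈ B) ∧ (∀ i, tv i ∉ B) ∧
  (∀ a, CAcceptable sv tv L (C a) (B ∩ C a)) ∧
  ∀ a b, a ≠ b → ∀ i, wiggle (L i) (B ∩ C b) (Bᶜ ∩ C a) ≤ z

/-- The vertices of `l` belonging to `C`, in order. -/
def inOrderIn (l : List V) (C : Set V) : List V := l.filter fun v => decide (v ∈ C)

/-- The last `m` (or "up to `m`") vertices of the path `P` in `C`, in order along `P`. -/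
def lastIn {G : Dgraph V} (P : Dpath G) (C : Set V) (m : ℕ) : List V :=
  (inOrderIn P.verts C).drop ((inOrderIn P.verts C).length - m)

/-- The first up-to-`m` vertices of the path `P` in `C`, in order along `P`. -/
def firstUpTo {G : Dgraph V} (P : Dpath G) (C : Set V) (m : ℕ) : List V :=
  (inOrderIn P.verts C).take m

/-- The set of terms of a vertex sequence. -/
def seqSet (X : List V) : Set V := {v | v ∈ X}

/-- `𝒜⁺` for a set `𝒜` of vertex sequences. -/
def plusSet (G : Dgraph V) {c : ℕ} (C : Fin c → Set V) (s : ℕ) (𝒜 : Set (List V)) : Set V :=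
  {v | ∃ X ∈ 𝒜, ∃ a, insert v (seqSet X) ⊆ C a ∧
    (v ∈ X ∨ (v ∉ X ∧ X.length = s ∧ ∀ u ∈ X.drop (X.length - (s - 1)), G.adj u v))}

/-- `𝒜⁻` for a set `𝒜` of vertex sequences. -/
def minusSet (G : Dgraph V) {c : ℕ} (C : Fin c → Set V) (s : ℕ) (𝒜 : Set (List V)) : Set V :=
  {v | ∃ X ∈ 𝒜, ∃ a, insert v (seqSet X) ⊆ C a ∧
    (v ∈ X ∨ (v ∉ X ∧ X.length = s ∧ ∀ u ∈ X.take (s - 1), G.adj v u))}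

/-- A set `D ⊆ V(G)` is `(r,s,t)`-restricted. -/
def Restricted (G : Dgraph V) {c : ℕ} (C : Fin c → Set V) (r s t : ℕ) (D : Set V) : Prop :=
  ∃ 𝒜 ℬ : Set (List V),
    (∀ X ∈ 𝒜, X.length ≤ s) ∧ (∀ X ∈ ℬ, X.length ≤ s) ∧
    𝒜.ncard ≤ r ∧ ℬ.ncard ≤ r ∧
    (plusSet G C s ℬ ∩ minusSet G C s 𝒜).ncard ≤ t ∧
    plusSet G C s ℬ \ minusSet G C s 𝒜 ⊆ D ∧
    D ⊆ plusSet G C s ℬ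

/-- `e` is an enumeration of `V(L) ∖ {s 1,…,s k,t 1,…,t k}`. -/
def IsEnumeration {G : Dgraph V} {k : ℕ} (L : Fin k → Dpath G) (sv tv : Fin k → V)
    (e : List V) : Prop :=
  e.Nodup ∧ {v | v ∈ e} = linkSupport L \ (Set.range sv ∪ Set.range tv)

/-- `B h = {s 1,…,s k} ∪ {v 1,…,v h}`, for the enumeration `e`. -/
def BsetOf {k : ℕ} (sv : Fin k → V) (e : List V) (h : ℕ) : Set V :=
  Set.range sv ∪ {v | v ∈ e.take h}

/-- `A h = V(L) ∖ B h`. -/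
def AsetOf {G : Dgraph V} {k : ℕ} (L : Fin k → Dpath G) (sv : Fin k → V) (e : List V)
    (h : ℕ) : Set V :=
  linkSupport L \ BsetOf sv e h

/-- The maximal subpaths of members of `L` with all vertices in `S`: the components,
included in `S`, of the digraph obtained from `P 1 ∪ ⋯ ∪ P k` by deleting the edges with
exactly one end in `S`. -/
def segsIn {G : Dgraph V} {k : ℕ} (L : Fin k → Dpath G) (S : Set V) : Set (Dpath G) :=
  {Q | ∃ i, Q.IsSubpath (L i) ∧ Q.support ⊆ S ∧
    ∀ Q' : Dpath G, Q'.IsSubpath (L i) → Q'.support ⊆ S → Q.IsSubpath Q' →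
      Q'.verts = Q.verts}

/-- `𝒜 h`: first up-to-`s` vertices in each `C a` of each path of `ℛ h`. -/
def AseqsOf (G : Dgraph V) {k c : ℕ} (C : Fin c → Set V) (s : ℕ) (L : Fin k → Dpath G)
    (sv : Fin k → V) (e : List V) (h : ℕ) : Set (List V) :=
  {X | ∃ R ∈ segsIn L (AsetOf L sv e h), ∃ a, X = firstUpTo R (C a) s}

/-- `ℬ h`: last up-to-`s` vertices in each `C a` of each path of `𝒬 h`. -/
def BseqsOf (G : Dgraph V) {k c : ℕ} (C : Fin c → Set V) (s : ℕ) (L : Fin k → Dpath G)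
    (sv : Fin k → V) (e : List V) (h : ℕ) : Set (List V) :=
  {X | ∃ Q ∈ segsIn L (BsetOf sv e h), ∃ a, X = lastIn Q (C a) s}

/-- `D h = (ℬ h⁺ ∖ 𝒜 h⁻) ∪ B h`. -/
def DsetOf (G : Dgraph V) {k c : ℕ} (C : Fin c → Set V) (s : ℕ) (L : Fin k → Dpath G)
    (sv : Fin k → V) (e : List V) (h : ℕ) : Set V :=
  (plusSet G C s (BseqsOf G C s L sv e h) \ minusSet G C s (AseqsOf G C s L sv e h))
    ∪ BsetOf sv e h

/-- The edges of the members of a linkage. -/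
def linkEdges {G : Dgraph V} {k : ℕ} (L : Fin k → Dpath G) : Set (V × V) :=
  ⋃ i, {p | p ∈ (L i).edges}

/-- `J h`: the edges of `P 1 ∪ ⋯ ∪ P k` with one end in `A h` and the other in `B h`. -/
def JsetOf {G : Dgraph V} {k : ℕ} (L : Fin k → Dpath G) (sv : Fin k → V) (e : List V)
    (h : ℕ) : Set (V × V) :=
  {p ∈ linkEdges L |
    (p.1 ∈ AsetOf L sv e h ∧ p.2 ∈ BsetOf sv e h) ∨
    (p.1 ∈ BsetOf sv e h ∧ p.2 ∈ AsetOf L sv e h)}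

/-- `Y h = {(e,i) : e ∈ J h ∩ E(P i)}`, as a set of coloured edges. -/
def YsetOf {G : Dgraph V} {k : ℕ} (L : Fin k → Dpath G) (sv : Fin k → V) (e : List V)
    (h : ℕ) : Set ((V × V) × Fin k) :=
  {p | p.1 ∈ JsetOf L sv e h ∧ p.1 ∈ (L p.2).edges}

/-- `ℰ`: the admissible sets of coloured edges (a coloured edge is a pair `(e,i)` with
`e ∈ E(G)` and `i` a colour in `Fin k`; its tail is `e.1` and its head is `e.2`). -/
def EdgeSets (G : Dgraph V) {k : ℕ} (sv tv : Fin k → V) (w : ℕ) :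
    Set (Set ((V × V) × Fin k)) :=
  {Y | (∀ p ∈ Y, G.adj p.1.1 p.1.2) ∧
    Y.ncard ≤ 2 * w - 1 ∧
    (∀ p ∈ Y, ∀ q ∈ Y, p ≠ q → p.1.2 ≠ q.1.2 ∧ p.1.1 ≠ q.1.1) ∧
    (∀ p ∈ Y, ∀ q ∈ Y, ({p.1.1, p.1.2} ∩ {q.1.1, q.1.2} : Set V).Nonempty → p.2 = q.2) ∧
    (∀ p ∈ Y, p.1.2 ∉ Set.range sv ∧ p.1.1 ∉ Set.range tv) ∧
    (∀ p ∈ Y, ∀ i, (p.1.1 = sv i → p.2 = i) ∧ (p.1.2 = tv i → p.2 = i))}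

/-- The vertices of the auxiliary digraph `H`: pairs `(Y,D)` with `Y ∈ ℰ`, `D ∈ 𝒟`
(i.e. `D` is `(r,s,t)`-restricted), such that every coloured edge of `Y` has exactly one
end in `D`. -/
def HVert (G : Dgraph V) {k c : ℕ} (sv tv : Fin k → V) (C : Fin c → Set V)
    (w r s t : ℕ) (x : Set ((V × V) × Fin k) × Set V) : Prop :=
  x.1 ∈ EdgeSets G sv tv w ∧ Restricted G C r s t x.2 ∧
  ∀ p ∈ x.1, Xor' (p.1.1 ∈ x.2) (p.1.2 ∈ x.2)

/-- Adjacency in the auxiliary digraph `H`. -/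
def HAdj (G : Dgraph V) {k c : ℕ} (sv tv : Fin k → V) (C : Fin c → Set V)
    (w r s t : ℕ) (x y : Set ((V × V) × Fin k) × Set V) : Prop :=
  x ≠ y ∧ HVert G sv tv C w r s t x ∧ HVert G sv tv C w r s t y ∧ x.2 ⊆ y.2 ∧
  ∃ p q : (V × V) × Fin k, p ≠ q ∧ symmDiff x.1 y.1 = {p, q} ∧
    p.1.2 = q.1.1 ∧ p.1.1 ≠ q.1.2 ∧ p.1.2 ∈ y.2 \ x.2

/-- The auxiliary digraph `H`. -/
def auxH (G : Dgraph V) {k c : ℕ} (sv tv : Fin k → V) (C : Fin c → Set V)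
    (w r s t : ℕ) : Dgraph (Set ((V × V) × Fin k) × Set V) :=
  ⟨HAdj G sv tv C w r s t, fun _ hx => hx.1 rfl⟩

/-- `S 0`: the vertices `(Y,D)` of `H` with `|Y| = k` and every member of `Y` having tail
in `{s 1,…,s k}`. -/
def S0set (G : Dgraph V) {k c : ℕ} (sv tv : Fin k → V) (C : Fin c → Set V)
    (w r s t : ℕ) : Set (Set ((V × V) × Fin k) × Set V) :=
  {x | HVert G sv tv C w r s t x ∧ x.1.ncard = k ∧ ∀ p ∈ x.1, p.1.1 ∈ Set.range sv}

/-- `T 0`: the vertices `(Y,D)` of `H` with `|Y| = k` and every member of `Y` having head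
in `{t 1,…,t k}`. -/
def T0set (G : Dgraph V) {k c : ℕ} (sv tv : Fin k → V) (C : Fin c → Set V)
    (w r s t : ℕ) : Set (Set ((V × V) × Fin k) × Set V) :=
  {x | HVert G sv tv C w r s t x ∧ x.1.ncard = k ∧ ∀ p ∈ x.1, p.1.2 ∈ Set.range tv}

end

/-- Reachability inside a vertex set. -/
def ReachIn {V : Type} (G : Dgraph V) (W : Set V) : V → V → Prop :=
  Relation.ReflTransGen (fun u v => G.adj u v ∧ u ∈ W ∧ v ∈ W)

lemma choose_lem {ι V : Type} (g : ι → ℕ → V) (t n : ℕ) (S : Finset ι)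
    (hg : ∀ i ∈ S, ∀ x < n, ∀ y < n, g i x = g i y → x = y) (hS : S.card * t ≤ n) :
    ∃ c : ι → ℕ → ℕ, (∀ i ∈ S, ∀ x < t, c i x < n) ∧
      (∀ i ∈ S, ∀ x y, x < y → y < t → c i x < c i y) ∧
      ∀ i ∈ S, ∀ j ∈ S, i ≠ j → ∀ x < t, ∀ y < t, g i (c i x) ≠ g j (c j y) := by
  classical
  induction S using Finset.induction_on with
  | empty => exact ⟨fun _ _ => 0, by simp, by simp, by simp⟩
  | insert i S hi ih =>
    rw [Finset.card_insert_of_notMem hi] at hS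
    obtain ⟨c, h1, h2, h3⟩ := ih (fun j hj => hg j (Finset.mem_insert_of_mem hj))
      (by nlinarith)
    set U : Finset V := (S ×ˢ Finset.range t).image (fun p => g p.1 (c p.1 p.2)) with hU
    have hUc : U.card ≤ S.card * t := by
      refine Finset.card_image_le.trans ?_
      simp
    have hbad : ((Finset.range n).filter (fun x => g i x ∈ U)).card ≤ U.card := by
      apply Finset.card_le_card_of_injOn (g i)
      · intro x hx
        simp at hx
        exact hx.2
      · intro x hx y hy hxy
        simp at hx hy
        exact hg i (Finset.mem_insert_self _ _) x hx.1 y hy.1 hxy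
    have hsum := Finset.card_filter_add_card_filter_not (s := Finset.range n) (fun x => g i x ∈ U)
    rw [Finset.card_range] at hsum
    have hgood : t ≤ ((Finset.range n).filter (fun x => ¬ g i x ∈ U)).card := by
      nlinarith
    obtain ⟨T, hT, hTc⟩ := Finset.exists_subset_card_eq hgood
    set d : ℕ → ℕ := fun x => if h : x < t then T.orderEmbOfFin hTc ⟨x, h⟩ else 0 with hd
    have hdT : ∀ x < t, d x ∈ T := by
      intro x hx
      simp only [hd, hx, dif_pos]
      exact Finset.orderEmbOfFin_mem _ _ _
    have hdn : ∀ x < t, d x < n ∧ g i (d x) ∉ U := by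
      intro x hx
      have := hT (hdT x hx)
      simpa using this
    have hdm : ∀ x y, x < y → y < t → d x < d y := by
      intro x y hxy hy
      have hx : x < t := hxy.trans hy
      simp only [hd, hx, hy, dif_pos]
      simpa using hxy
    have hne : ∀ j ∈ S, j ≠ i := fun j hj h => hi (h ▸ hj)
    have hnU : ∀ j ∈ S, ∀ x < t, ∀ y < t, g i (d x) ≠ g j (c j y) := by
      intro j hj x hx y hy h
      apply (hdn x hx).2
      rw [h, hU, Finset.mem_image]
      exact ⟨(j, y), by simp [hj, hy], rfl⟩
    refine ⟨Function.update c i d, ?_, ?_, ?_⟩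
    · intro j hj x hx
      rcases Finset.mem_insert.1 hj with rfl | hj
      · simpa using (hdn x hx).1
      · rw [Function.update_of_ne (hne j hj)]
        exact h1 j hj x hx
    · intro j hj x y hxy hy
      rcases Finset.mem_insert.1 hj with rfl | hj
      · simpa using hdm x y hxy hy
      · rw [Function.update_of_ne (hne j hj)]
        exact h2 j hj x y hxy hy
    · intro j hj j' hj' hjj x hx y hy
      rcases Finset.mem_insert.1 hj with rfl | hm
      · rcases Finset.mem_insert.1 hj' with rfl | hm'
        · exact absurd rfl hjj
        · rw [Function.update_of_ne (hne j' hm'), Function.update_self]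
          exact hnU j' hm' x hx y hy
      · rcases Finset.mem_insert.1 hj' with rfl | hm'
        · rw [Function.update_of_ne (hne j hm), Function.update_self]
          exact (hnU j hm y hy x hx).symm
        · rw [Function.update_of_ne (hne j hm), Function.update_of_ne (hne j' hm')]
          exact h3 j hm j' hm' hjj x hx y hy

lemma exists_path_of_reach {V : Type} {G : Dgraph V} {W : Set V} {x y : V}
    (hy : y ∈ W) (h : ReachIn G W x y) :
    ∃ P : Dpath G, P.first = x ∧ P.last = y ∧ P.support ⊆ W := by
  classical
  unfold ReachIn at h
  induction h using Relation.ReflTransGen.head_induction_on with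
  | refl =>
    refine ⟨⟨[y], by simp, by simp, by simp [List.Chain']⟩, rfl, rfl, ?_⟩
    intro v hv
    simp [Dpath.support] at hv
    exact hv ▸ hy
  | head h1 h2 ih =>
    rename_i a c
    obtain ⟨P, hf, hl, hs⟩ := ih
    by_cases ha : a ∈ P.verts
    · obtain ⟨l1, l2, he⟩ := List.append_of_mem ha
      have hch := P.chain
      have hnd := P.nodup
      rw [he] at hch hnd
      refine ⟨⟨a :: l2, by simp, hnd.of_append_right, (List.isChain_append.1 hch).2.1⟩, rfl, ?_, ?_⟩
      · rw [← hl]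
        simp [Dpath.last, he]
      · intro v hv
        apply hs
        change v ∈ P.verts
        rw [he]
        exact List.mem_append_right _ hv
    · have hne := P.ne
      refine ⟨⟨a :: P.verts, by simp, List.nodup_cons.2 ⟨ha, P.nodup⟩, ?_⟩, rfl, ?_, ?_⟩
      · apply List.isChain_cons.2
        refine ⟨?_, P.chain⟩
        intro z hz
        have : z = c := by
          rw [← hf]
          unfold Dpath.first
          rw [List.head?_eq_some_head hne] at hz
          simpa using hz.symm
        exact this ▸ h1.1
      · rw [← hl]
        exact List.getLast_cons hne
      · intro v hv
        rcases List.mem_cons.1 hv with rfl | hv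
        · exact h1.2.1
        · exact hs hv

/-- Position of a vertex on a path. -/
noncomputable def posOn {V : Type} {G : Dgraph V} (P : Dpath G) (v : V) : ℕ := P.verts.idxOf v

lemma posOn_inj {V : Type} {G : Dgraph V} (P : Dpath G) {u v : V} (hu : u ∈ P.support)
    (h : posOn P u = posOn P v) : u = v :=
  (List.idxOf_inj hu).1 h

lemma posOn_getElem {V : Type} {G : Dgraph V} (P : Dpath G) (n : ℕ) (h : n < P.verts.length) :
    posOn P (P.verts[n]) = n := P.nodup.idxOf_getElem n h

lemma exists_posOn {V : Type} {G : Dgraph V} (P : Dpath G) {u : V} (hu : u ∈ P.support) :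
    ∃ h : posOn P u < P.verts.length, P.verts[posOn P u] = u :=
  ⟨List.idxOf_lt_length_iff.2 hu, List.getElem_idxOf _⟩

lemma first_mem {V : Type} {G : Dgraph V} (P : Dpath G) : P.first ∈ P.support := List.head_mem P.ne

lemma last_mem {V : Type} {G : Dgraph V} (P : Dpath G) : P.last ∈ P.support := List.getLast_mem P.ne

lemma posOn_first {V : Type} {G : Dgraph V} (P : Dpath G) : posOn P P.first = 0 := by
  have h : 0 < P.verts.length := List.length_pos_iff.2 P.ne
  have := posOn_getElem P 0 h
  rwa [← List.head_eq_getElem P.ne] at this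

lemma posOn_le_last {V : Type} {G : Dgraph V} (P : Dpath G) {u : V} (hu : u ∈ P.support) :
    posOn P u ≤ posOn P P.last := by
  have h : 0 < P.verts.length := List.length_pos_iff.2 P.ne
  have h2 := posOn_getElem P (P.verts.length - 1) (by omega)
  rw [← List.getLast_eq_getElem P.ne] at h2
  obtain ⟨h3, -⟩ := exists_posOn P hu
  unfold Dpath.last
  omega

lemma reach_seg {V : Type} {G : Dgraph V} (P : Dpath G) {W : Set V} {u v : V}
    (hu : u ∈ P.support) (hv : v ∈ P.support) (huv : posOn P u ≤ posOn P v)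
    (hW : ∀ w ∈ P.support, posOn P u ≤ posOn P w → posOn P w ≤ posOn P v → w ∈ W) :
    ReachIn G W u v := by
  have key : ∀ m n : ℕ, m ≤ n → ∀ (hn : n < P.verts.length) (hm : m < P.verts.length),
      (∀ x (hx : x < P.verts.length), m ≤ x → x ≤ n → P.verts[x] ∈ W) →
      ReachIn G W P.verts[m] P.verts[n] := by
    intro m n hmn
    induction n, hmn using Nat.le_induction with
    | base => intro _ _ _; exact Relation.ReflTransGen.refl
    | succ n hmn ih =>
      intro hn hm h
      refine Relation.ReflTransGen.tail (ih (by omega) hm fun x hx h1 h2 => h x hx h1 (by omega)) ?_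
      exact ⟨List.isChain_iff_getElem.1 P.chain n (by omega), h n (by omega) hmn (by omega),
        h (n+1) hn (by omega) le_rfl⟩
  obtain ⟨h1, h2⟩ := exists_posOn P hu
  obtain ⟨h3, h4⟩ := exists_posOn P hv
  have := key _ _ huv h3 h1 (by
    intro x hx hx1 hx2
    apply hW _ (List.getElem_mem hx)
    · rwa [posOn_getElem]
    · rwa [posOn_getElem])
  rwa [h2, h4] at this

lemma min_reach {V : Type} [Fintype V] {k : ℕ} {G : Dgraph V} {L : Fin k → Dpath G}
    (hL : IsMinimumLinkage L) (W : Fin k → Set V)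
    (hd : ∀ i j, i ≠ j → ∀ v, v ∈ W i → v ∉ W j)
    (hm : ∀ i, (L i).last ∈ W i)
    (hr : ∀ i, ReachIn G (W i) (L i).first (L i).last) :
    (linkSupport L).ncard ≤ (⋃ i, W i).ncard := by
  choose L' h1 h2 h3 using fun i => exists_path_of_reach (hm i) (hr i)
  refine (hL.2 L' ?_ fun i => ⟨h1 i, h2 i⟩).trans ?_
  · intro i j hij
    rw [Set.disjoint_left]
    intro v hv hv'
    exact hd i j hij v (h3 i hv) (h3 j hv')
  · apply Set.ncard_le_ncard _ (Set.toFinite _)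
    exact Set.iUnion_mono h3

lemma no_shortcut {V : Type} [Fintype V] {k : ℕ} {G : Dgraph V} {L : Fin k → Dpath G}
    (hL : IsMinimumLinkage L) (i : Fin k) {b a : V} (hb : b ∈ (L i).support)
    (ha : a ∈ (L i).support) (hba : posOn (L i) b + 1 < posOn (L i) a) : ¬ G.adj b a := by
  intro hadj
  set W : Fin k → Set V := fun j => {v | v ∈ (L j).support ∧
    (j = i → (posOn (L i) v ≤ posOn (L i) b ∨ posOn (L i) a ≤ posOn (L i) v))} with hW
  have hlt := posOn_le_last (L i) ha
  have := min_reach hL W ?_ ?_ ?_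
  · obtain ⟨hlen, -⟩ := exists_posOn (L i) ha
    set w := (L i).verts[posOn (L i) b + 1]'(by omega) with hw
    have hwp : posOn (L i) w = posOn (L i) b + 1 := posOn_getElem _ _ _
    have hwm : w ∈ (L i).support := List.getElem_mem _
    refine absurd this (not_le.2 (Set.ncard_lt_ncard ?_ (Set.toFinite _)))
    refine ⟨Set.iUnion_mono fun j v hv => hv.1, fun hsub => ?_⟩
    have hwL : w ∈ linkSupport L := Set.mem_iUnion.2 ⟨i, hwm⟩
    obtain ⟨j, hj⟩ := Set.mem_iUnion.1 (hsub hwL)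
    have hji : j = i := by
      by_contra hne
      exact Set.disjoint_left.1 (hL.1 j i hne) hj.1 hwm
    rcases hj.2 hji with h | h <;> omega
  · intro j j' hjj v hv hv'
    exact Set.disjoint_left.1 (hL.1 j j' hjj) hv.1 hv'.1
  · intro j
    refine ⟨last_mem _, ?_⟩
    rintro rfl
    exact Or.inr hlt
  · intro j
    by_cases hj : j = i
    · subst hj
      have hbW : b ∈ W j := ⟨hb, fun _ => Or.inl le_rfl⟩
      have haW : a ∈ W j := ⟨ha, fun _ => Or.inr le_rfl⟩
      refine Relation.ReflTransGen.trans (b := b) ?_ (Relation.ReflTransGen.head (b := a)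
        ⟨hadj, hbW, haW⟩ ?_)
      · apply reach_seg (L j) (first_mem _) hb (by rw [posOn_first]; omega)
        intro w hw _ h
        exact ⟨hw, fun _ => Or.inl h⟩
      · apply reach_seg (L j) ha (last_mem _) hlt
        intro w hw h _
        exact ⟨hw, fun _ => Or.inr h⟩
    · apply reach_seg (L j) (first_mem _) (last_mem _) (by rw [posOn_first]; omega)
      intro w hw _ _
      exact ⟨hw, fun h => absurd h hj⟩

lemma exists_cycle {k : ℕ} (f : Fin k → Fin k) (p : Fin k → Prop) (hf : ∀ i, p i → p (f i))
    (i0 : Fin k) (h0 : p i0) :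
    ∃ (S : Finset (Fin k)) (t : ℕ), 1 ≤ t ∧ t ≤ k ∧ S.Nonempty ∧ (∀ i ∈ S, p i) ∧
      (∀ i ∈ S, f i ∈ S) ∧ ∀ i ∈ S, f^[t] i = i := by
  classical
  have hp : ∀ n, p (f^[n] i0) := by
    intro n
    induction n with
    | zero => exact h0
    | succ n ih => rw [Function.iterate_succ_apply']; exact hf _ ih
  obtain ⟨x, hx, y, hy, hxy, he⟩ := Finset.exists_ne_map_eq_of_card_lt_of_maps_to
    (s := Finset.range (k + 1)) (t := (Finset.univ : Finset (Fin k)))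
    (f := fun n => f^[n] i0) (by simp) (by intro _ _; simp)
  wlog hlt : x < y generalizing x y
  · exact this y hy x hx hxy.symm he.symm (by omega)
  simp only [Finset.mem_range] at hx hy
  set j0 := f^[x] i0 with hj0
  have hper : f^[y - x] j0 = j0 := by
    rw [hj0, ← Function.iterate_add_apply, Nat.sub_add_cancel hlt.le]
    exact he.symm
  have hper' : ∀ n, f^[y - x] (f^[n] j0) = f^[n] j0 := by
    intro n
    rw [← Function.iterate_add_apply, Nat.add_comm, Function.iterate_add_apply, hper]
  refine ⟨Finset.univ.filter (fun i => ∃ n, i = f^[n] j0), y - x, by omega, by omega,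
    ⟨j0, by simp; exact ⟨0, rfl⟩⟩, ?_, ?_, ?_⟩
  · intro i hi
    simp at hi
    obtain ⟨n, rfl⟩ := hi
    rw [hj0, ← Function.iterate_add_apply]
    exact hp _
  · intro i hi
    simp at hi ⊢
    obtain ⟨n, rfl⟩ := hi
    exact ⟨n + 1, (Function.iterate_succ_apply' f n j0).symm⟩
  · intro i hi
    simp at hi
    obtain ⟨n, rfl⟩ := hi
    exact hper' n

lemma sublist_pos {V : Type} {G : Dgraph V} (P : Dpath G) {n : ℕ} (F : Fin n → V)
    (h : (List.ofFn F).Sublist P.verts) :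
    (∀ x, F x ∈ P.support) ∧ ∀ x y, x < y → posOn P (F x) < posOn P (F y) := by
  refine ⟨fun x => h.subset (by simp), ?_⟩
  obtain ⟨e, he⟩ := List.sublist_iff_exists_fin_orderEmbedding_get_eq.1 h
  have key : ∀ x : Fin n, posOn P (F x) = e ⟨x, by simp⟩ := by
    intro x
    have := he ⟨x, by simp⟩
    simp only [List.get_eq_getElem, List.getElem_ofFn] at this
    rw [this]
    exact posOn_getElem _ _ _
  intro x y hxy
  rw [key, key]
  exact e.strictMono hxy

/-- A short path between distinct vertices, by its middle vertex (or last if none). -/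
lemma short_path {V : Type} {G : Dgraph V} (P : Dpath G) (h3 : P.verts.length ≤ 3)
    (hne : P.first ≠ P.last) :
    ∃ g ∈ P.support, (g = P.last ∧ G.adj P.first P.last) ∨
      (g ≠ P.first ∧ g ≠ P.last ∧ G.adj P.first g ∧ G.adj g P.last) := by
  obtain ⟨l, h1, h2, h4⟩ := P
  match l, h1, h2, h4, h3, hne with
  | [a], _, _, _, _, hne => exact absurd rfl hne
  | [a, b], _, h2, h4, _, _ =>
    refine ⟨b, by simp [Dpath.support], Or.inl ⟨rfl, ?_⟩⟩
    have := List.isChain_cons_cons.1 h4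
    exact this.1
  | [a, b, c], _, h2, h4, _, _ =>
    refine ⟨b, by simp [Dpath.support], Or.inr ?_⟩
    have h5 := List.isChain_cons_cons.1 h4
    have h6 := List.isChain_cons_cons.1 h5.2
    simp at h2
    exact ⟨fun h => h2.1.1 h.symm, h2.2, h5.1, h6.1⟩
  | a :: b :: c :: d :: l, _, _, _, h3, _ => simp at h3; omega

/-- The data of a matching from `B` on `L i` to `C \ B` on `L j`. -/
def MatchData {V : Type} {k : ℕ} {G : Dgraph V} (L : Fin k → Dpath G) (C B : Set V) (N : ℕ)
    (i j : Fin k) (b g a : ℕ → V) : Prop :=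
  (∀ x < N, b x ∈ B ∧ b x ∈ (L i).support) ∧
  (∀ x < N, a x ∈ C \ B ∧ a x ∈ (L j).support) ∧
  (∀ x y, x < y → y < N → posOn (L i) (b x) < posOn (L i) (b y)) ∧
  (∀ x y, x < y → y < N → posOn (L j) (a x) < posOn (L j) (a y)) ∧
  (∀ x < N, (g x = a x ∧ G.adj (b x) (a x)) ∨
    (g x ∉ linkSupport L ∧ G.adj (b x) (g x) ∧ G.adj (g x) (a x))) ∧
  ∀ x < N, ∀ y < N, g x = g y → x = y

lemma before_of_initial {V : Type} {G : Dgraph V} {P Q : Dpath G} {C B : Set V}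
    (hBC : B ⊆ C) (hQ : Q.IsInitialSubpath P) (hQC : Q.support ∩ C = P.support ∩ B)
    {b a : V} (hb : b ∈ B) (hbP : b ∈ P.support) (ha : a ∈ C) (haB : a ∉ B)
    (haP : a ∈ P.support) : posOn P b < posOn P a := by
  obtain ⟨l, hl⟩ := hQ
  have hbQ : b ∈ Q.verts := by
    have : b ∈ Q.support ∩ C := by rw [hQC]; exact ⟨hbP, hb⟩
    exact this.1
  have haQ : a ∉ Q.verts := by
    intro h
    have : a ∈ P.support ∩ B := by rw [← hQC]; exact ⟨h, ha⟩
    exact haB this.2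
  unfold posOn
  rw [← hl, List.idxOf_append_of_mem hbQ, List.idxOf_append_of_notMem haQ]
  have := List.idxOf_lt_length_iff.2 hbQ
  omega

lemma exists_take {V : Type} {G : Dgraph V} (P : Dpath G) (n : ℕ) :
    ∃ Q : Dpath G, Q.IsInitialSubpath P ∧
      ∀ v, v ∈ Q.support ↔ v ∈ P.support ∧ posOn P v ≤ n := by
  refine ⟨⟨P.verts.take (n + 1), by simpa using P.ne, P.nodup.sublist (List.take_sublist _ _),
    P.chain.take _⟩, List.take_prefix _ _, ?_⟩
  intro v
  constructor
  · intro hv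
    change v ∈ P.verts.take (n + 1) at hv
    obtain ⟨m, hm, rfl⟩ := List.mem_take_iff_getElem.1 hv
    refine ⟨List.getElem_mem _, ?_⟩
    rw [posOn_getElem]
    omega
  · rintro ⟨hv, hn⟩
    obtain ⟨h1, h2⟩ := exists_posOn P hv
    exact List.mem_take_iff_getElem.2 ⟨posOn P v, by omega, h2⟩

lemma link_uniq {V : Type} {k : ℕ} {G : Dgraph V} {L : Fin k → Dpath G} (hL : IsLinkage L)
    {i j : Fin k} {v : V} (hi : v ∈ (L i).support) (hj : v ∈ (L j).support) : i = j := by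
  by_contra h
  exact Set.disjoint_left.1 (hL i j h) hi hj

lemma extract_matching {V : Type} [Fintype V] {k : ℕ} (G : Dgraph V)
    (sv tv : Fin k → V) (L : Fin k → Dpath G) (hL : IsLinkageFor L sv tv)
    (C B : Set V) (hacc : CAcceptable sv tv L C B)
    (hno : ∀ v ∈ (linkSupport L ∩ C) \ (B ∪ Set.range tv), ¬ CAcceptable sv tv L C (insert v B))
    (i : Fin k) (hi : ∃ v ∈ (L i).support, v ∈ C ∧ v ∉ B ∧ v ≠ (L i).last) :
    ∃ (j : Fin k) (b g a : ℕ → V),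
      (∃ v ∈ (L j).support, v ∈ C ∧ v ∉ B ∧ v ≠ (L j).last) ∧
      MatchData L C B (k ^ 2 + k + 1) i j b g a := by
  classical
  obtain ⟨hBC, hs, ht, hini, hmat⟩ := hacc
  have hBA : ∀ i, ∀ b ∈ B, b ∈ (L i).support → ∀ a ∈ C, a ∉ B → a ∈ (L i).support →
      posOn (L i) b < posOn (L i) a := by
    intro i b hb hbP a ha haB haP
    obtain ⟨Q, hQ, hQC⟩ := hini i
    exact before_of_initial hBC hQ hQC hb hbP ha haB haP
  obtain ⟨v, hv, hvC, hvB, hvl⟩ := hi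
  obtain ⟨r, ⟨hrP, hrC, hrB⟩, hrmin⟩ := Set.exists_min_image
    {v | v ∈ (L i).support ∧ v ∈ C ∧ v ∉ B} (posOn (L i)) (Set.toFinite _) ⟨v, hv, hvC, hvB⟩
  have hrl : r ≠ (L i).last := by
    rintro rfl
    exact hvl (posOn_inj _ hv (le_antisymm (posOn_le_last _ hv) (hrmin v ⟨hv, hvC, hvB⟩)))
  have hrt : r ∉ Set.range tv := by
    rintro ⟨j, hj⟩
    rw [← (hL.2 j).2] at hj
    have : j = i := link_uniq hL.1 (last_mem (L j)) (hj ▸ hrP)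
    subst this
    exact hrl hj.symm
  have hnot := hno r ⟨⟨Set.mem_iUnion.2 ⟨i, hrP⟩, hrC⟩, by
    rintro (h | h)
    · exact hrB h
    · exact hrt h⟩
  have hM : ∃ i' j' : Fin k, ∃ M : Fin (k ^ 2 + k + 2) → Dpath G,
      IsPlanarMatchingFromTo (L i') (L j') M (insert r B) (C \ insert r B) ∧
        InternallyDisjointFrom M L := by
    by_contra hcon
    push Not at hcon
    apply hnot
    refine ⟨Set.insert_subset hrC hBC, hs.trans (Set.subset_insert _ _), ?_, ?_, ?_⟩
    · rw [Set.eq_empty_iff_forall_notMem] at ht ⊢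
      rintro w ⟨h1, rfl | h2⟩
      · exact hrt h1
      · exact ht w ⟨h1, h2⟩
    · intro j
      by_cases hj : j = i
      · subst hj
        obtain ⟨Q, hQ, hQm⟩ := exists_take (L j) (posOn (L j) r)
        refine ⟨Q, hQ, ?_⟩
        ext w
        constructor
        · rintro ⟨hw, hwC⟩
          obtain ⟨h1, h2⟩ := (hQm w).1 hw
          refine ⟨h1, ?_⟩
          by_cases hwB : w ∈ B
          · exact Or.inr hwB
          · exact Or.inl (posOn_inj _ h1 (le_antisymm h2 (hrmin w ⟨h1, hwC, hwB⟩)))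
        · rintro ⟨h1, rfl | h2⟩
          · exact ⟨(hQm _).2 ⟨h1, le_rfl⟩, hrC⟩
          · exact ⟨(hQm _).2 ⟨h1, (hBA j w h2 h1 r hrC hrB hrP).le⟩, hBC h2⟩
      · obtain ⟨Q, hQ, hQC⟩ := hini j
        refine ⟨Q, hQ, ?_⟩
        rw [hQC]
        ext w
        constructor
        · rintro ⟨h1, h2⟩
          exact ⟨h1, Or.inr h2⟩
        · rintro ⟨h1, rfl | h2⟩
          · exact absurd (link_uniq hL.1 h1 hrP) hj
          · exact ⟨h1, h2⟩
    · rintro i' j' ⟨M, h1, h2⟩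
      exact hcon i' j' M h1 h2
  obtain ⟨i', j, M, ⟨⟨hMl, hM3, hMf, hMt⟩, hMfl⟩, hMint⟩ := hM
  obtain ⟨hF1, hF2⟩ := sublist_pos _ _ hMf
  obtain ⟨hT1, hT2⟩ := sublist_pos _ _ hMt
  have hex : ∃ x, (M x).first = r := by
    by_contra hcon
    push Not at hcon
    refine hmat i' j ⟨M, ⟨⟨hMl, hM3, hMf, hMt⟩, fun x => ⟨?_, ?_⟩⟩, hMint⟩
    · exact (hMfl x).1.resolve_left (hcon x)
    · exact ⟨(hMfl x).2.1, fun h => (hMfl x).2.2 (Or.inr h)⟩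
  have hii : i' = i := by
    obtain ⟨x, hx⟩ := hex
    exact link_uniq hL.1 (hF1 x) (hx ▸ hrP)
  subst hii
  have hshort : ∀ x, ∃ g ∈ (M x).support, (g = (M x).last ∧ G.adj (M x).first (M x).last) ∨
      (g ≠ (M x).first ∧ g ≠ (M x).last ∧ G.adj (M x).first g ∧ G.adj g (M x).last) := by
    intro x
    apply short_path _ (hM3 x)
    intro h
    apply (hMfl x).2.2
    rw [← h]
    exact (hMfl x).1
  choose g hg1 hg2 using hshort
  let E : ℕ → Fin (k ^ 2 + k + 2) := fun x => if h : x < k ^ 2 + k + 2 then ⟨x, h⟩ else 0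
  have hE : ∀ x, x < k ^ 2 + k + 2 → (E x : ℕ) = x := by
    intro x hx
    simp [E, hx]
  have hElt : ∀ x y, x < y → y < k ^ 2 + k + 2 → E x < E y := by
    intro x y hxy hy
    rw [Fin.lt_def, hE x (by omega), hE y hy]
    exact hxy
  refine ⟨j, fun x => (M (E x)).first, fun x => g (E x), fun x => (M (E x)).last, ?_, ?_⟩
  · refine ⟨(M (E 0)).last, hT1 _, (hMfl _).2.1, fun h => (hMfl _).2.2 (Or.inr h), ?_⟩
    intro h
    have h1 := hT2 _ _ (hElt 0 1 (by omega) (by omega))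
    have h2 := posOn_le_last (L j) (hT1 (E 1))
    rw [h] at h1
    omega
  · refine ⟨?_, ?_, ?_, ?_, ?_, ?_⟩
    · intro x hx
      refine ⟨?_, hF1 _⟩
      rcases (hMfl (E x)).1 with h | h
      · exfalso
        have hlt := hF2 _ _ (hElt x (x + 1) (by omega) (by omega))
        rw [h] at hlt
        rcases (hMfl (E (x + 1))).1 with h' | h'
        · rw [h'] at hlt
          omega
        · have := hBA i' _ h' (hF1 _) r hrC hrB hrP
          omega
      · exact h
    · intro x hx
      exact ⟨⟨(hMfl _).2.1, fun h => (hMfl _).2.2 (Or.inr h)⟩, hT1 _⟩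
    · intro x y hxy hy
      exact hF2 _ _ (hElt x y hxy (by omega))
    · intro x y hxy hy
      exact hT2 _ _ (hElt x y hxy (by omega))
    · intro x hx
      rcases hg2 (E x) with h | ⟨h1, h2, h3, h4⟩
      · exact Or.inl h
      · refine Or.inr ⟨hMint _ ⟨Set.mem_iUnion.2 ⟨E x, hg1 _⟩, ?_⟩, h3, h4⟩
        rintro (⟨y, hy⟩ | ⟨y, hy⟩)
        · simp only at hy
          have : y = E x := link_uniq hMl (first_mem (M y)) (hy ▸ hg1 _)
          subst this
          exact h1 hy.symm
        · simp only at hy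
          have : y = E x := link_uniq hMl (last_mem (M y)) (hy ▸ hg1 _)
          subst this
          exact h2 hy.symm
    · intro x hx y hy h
      simp only at h
      have h5 : E x = E y := link_uniq hMl (hg1 _) (h ▸ hg1 _)
      have := congrArg Fin.val h5
      rw [hE x (by omega), hE y (by omega)] at this
      exact this

lemma no_cycle {V : Type} [Fintype V] {k : ℕ} {G : Dgraph V} {L : Fin k → Dpath G}
    (hL : IsMinimumLinkage L) (C B : Set V) (hC : G.IsClique C) (hBC : B ⊆ C)
    (hBA : ∀ i, ∀ b ∈ B, b ∈ (L i).support → ∀ a ∈ C, a ∉ B → a ∈ (L i).support →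
      posOn (L i) b < posOn (L i) a)
    (f : Fin k → Fin k) (b g a : Fin k → ℕ → V) (S : Finset (Fin k)) (t : ℕ)
    (ht1 : 1 ≤ t) (htk : t ≤ k) (hSne : S.Nonempty) (hfS : ∀ i ∈ S, f i ∈ S)
    (hft : ∀ i ∈ S, f^[t] i = i)
    (hM : ∀ i ∈ S, MatchData L C B (k ^ 2 + k + 1) i (f i) (b i) (g i) (a i)) : False := by
  classical
  have hSk : S.card ≤ k := by simpa using Finset.card_le_univ S
  obtain ⟨c, hc1, hc2, hc3⟩ := choose_lem g t (k ^ 2) S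
    (fun i hi x hx y hy h => (hM i hi).2.2.2.2.2 x (by omega) y (by omega) h)
    (by rw [sq]; exact Nat.mul_le_mul hSk htk)
  have huniq : ∀ {i j : Fin k} {v : V}, v ∈ (L i).support → v ∈ (L j).support → i = j :=
    fun h1 h2 => link_uniq hL.1 h1 h2
  have hsup : ∀ {i : Fin k} {v : V}, v ∈ (L i).support → v ∈ linkSupport L :=
    fun {i} {v} h => Set.mem_iUnion.2 ⟨i, h⟩
  have finj : ∀ i ∈ S, ∀ j ∈ S, f i = f j → i = j := by
    intro i hi j hj h
    obtain ⟨u, rfl⟩ : ∃ u, t = u + 1 := ⟨t - 1, by omega⟩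
    rw [← hft i hi, ← hft j hj, Function.iterate_succ_apply, Function.iterate_succ_apply, h]
  have fS : ∀ n, ∀ i ∈ S, f^[n] i ∈ S := by
    intro n
    induction n with
    | zero => intro i hi; exact hi
    | succ n ih => intro i hi; rw [Function.iterate_succ_apply]; exact ih _ (hfS i hi)
  have fninj : ∀ n, ∀ i ∈ S, ∀ j ∈ S, f^[n] i = f^[n] j → i = j := by
    intro n
    induction n with
    | zero => intro i _ j _ h; exact h
    | succ n ih =>
      intro i hi j hj h
      rw [Function.iterate_succ_apply, Function.iterate_succ_apply] at h
      exact finj i hi j hj (ih _ (hfS i hi) _ (hfS j hj) h)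
  set bb : Fin k → ℕ → V := fun j x => b j (c j x) with hbb
  set gg : Fin k → ℕ → V := fun j x => g j (c j x) with hgg
  set aa : Fin k → ℕ → V := fun j x => a j (c j x) with haa
  set e : Fin k → ℕ → V := fun j y => b j (k ^ 2 + y) with he
  have hcN : ∀ j ∈ S, ∀ x < t, c j x < k ^ 2 + k + 1 := by
    intro j hj x hx
    have := hc1 j hj x hx
    omega
  have F1 : ∀ j ∈ S, ∀ x < t, bb j x ∈ B ∧ bb j x ∈ (L j).support :=
    fun j hj x hx => (hM j hj).1 _ (hcN j hj x hx)
  have F2 : ∀ j ∈ S, ∀ x < t, aa j x ∈ C \ B ∧ aa j x ∈ (L (f j)).support :=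
    fun j hj x hx => (hM j hj).2.1 _ (hcN j hj x hx)
  have F3 : ∀ j ∈ S, ∀ x y, x < y → y < t → posOn (L j) (bb j x) < posOn (L j) (bb j y) :=
    fun j hj x y hxy hy => (hM j hj).2.2.1 _ _ (hc2 j hj x y hxy hy) (hcN j hj y hy)
  have F4 : ∀ j ∈ S, ∀ x y, x < y → y < t →
      posOn (L (f j)) (aa j x) < posOn (L (f j)) (aa j y) :=
    fun j hj x y hxy hy => (hM j hj).2.2.2.1 _ _ (hc2 j hj x y hxy hy) (hcN j hj y hy)
  have F5 : ∀ j ∈ S, ∀ x < t, (gg j x = aa j x ∧ G.adj (bb j x) (aa j x)) ∨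
      (gg j x ∉ linkSupport L ∧ G.adj (bb j x) (gg j x) ∧ G.adj (gg j x) (aa j x)) :=
    fun j hj x hx => (hM j hj).2.2.2.2.1 _ (hcN j hj x hx)
  have cinj : ∀ j ∈ S, ∀ x < t, ∀ y < t, c j x = c j y → x = y := by
    intro j hj x hx y hy h
    rcases lt_trichotomy x y with h1 | h1 | h1
    · have := hc2 j hj x y h1 hy
      omega
    · exact h1
    · have := hc2 j hj y x h1 hx
      omega
  have F6 : ∀ j ∈ S, ∀ j' ∈ S, ∀ x < t, ∀ x' < t, gg j x = gg j' x' → j = j' ∧ x = x' := by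
    intro j hj j' hj' x hx x' hx' h
    by_cases hjj : j = j'
    · subst hjj
      exact ⟨rfl, cinj j hj x hx x' hx' ((hM j hj).2.2.2.2.2 _ (hcN j hj x hx) _
        (hcN j hj x' hx') h)⟩
    · exact absurd h (hc3 j hj j' hj' hjj x hx x' hx')
  have F3' : ∀ j ∈ S, ∀ x < t, ∀ x' < t, bb j x = bb j x' → x = x' := by
    intro j hj x hx x' hx' h
    rcases lt_trichotomy x x' with h1 | h1 | h1
    · have := F3 j hj _ _ h1 hx'
      rw [h] at this
      omega
    · exact h1
    · have := F3 j hj _ _ h1 hx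
      rw [h] at this
      omega
  have F4' : ∀ j ∈ S, ∀ x < t, ∀ x' < t, aa j x = aa j x' → x = x' := by
    intro j hj x hx x' hx' h
    rcases lt_trichotomy x x' with h1 | h1 | h1
    · have := F4 j hj _ _ h1 hx'
      rw [h] at this
      omega
    · exact h1
    · have := F4 j hj _ _ h1 hx
      rw [h] at this
      omega
  have E1 : ∀ j ∈ S, ∀ y < k + 1, e j y ∈ B ∧ e j y ∈ (L j).support :=
    fun j hj y hy => (hM j hj).1 _ (by omega)
  have E2 : ∀ j ∈ S, ∀ x < t, ∀ y < k + 1, posOn (L j) (bb j x) < posOn (L j) (e j y) := by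
    intro j hj x hx y hy
    have := hc1 j hj x hx
    exact (hM j hj).2.2.1 _ _ (by omega) (by omega)
  have E3 : ∀ j ∈ S, ∀ y < k + 1, ∀ y' < k + 1, e j y = e j y' → y = y' := by
    intro j hj y hy y' hy' h
    have h1 : ∀ y y', y < y' → y' < k + 1 → posOn (L j) (e j y) < posOn (L j) (e j y') :=
      fun y y' h1 h2 => (hM j hj).2.2.1 _ _ (by omega) (by omega)
    rcases lt_trichotomy y y' with h2 | h2 | h2
    · have := h1 _ _ h2 hy'
      rw [h] at this
      omega
    · exact h2
    · have := h1 _ _ h2 hy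
      rw [h] at this
      omega
  clear_value bb gg aa e
  have hfp : ∀ i ∈ S, f (f^[t - 1] i) = i := by
    intro i hi
    rw [← Function.iterate_succ_apply' f (t - 1) i, Nat.succ_eq_add_one, Nat.sub_add_cancel ht1]
    exact hft i hi
  let core : Fin k → V → Prop := fun i v => v ∈ (L i).support ∧
    (i ∈ S → (posOn (L i) v ≤ posOn (L i) (bb i 0) ∨
      posOn (L i) (aa (f^[t - 1] i) (t - 1)) ≤ posOn (L i) v))
  let jump : Fin k → V → Prop := fun i v => i ∈ S ∧ ∃ x < t,
    v = bb (f^[x] i) x ∨ (v = gg (f^[x] i) x ∧ v ∉ linkSupport L) ∨ v = aa (f^[x] i) x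
  let W : Fin k → Set V := fun i => {v | core i v ∨ jump i v}
  -- facts about `aa` on its path
  have F2i : ∀ i ∈ S, aa (f^[t - 1] i) (t - 1) ∈ C \ B ∧
      aa (f^[t - 1] i) (t - 1) ∈ (L i).support := by
    intro i hi
    have := F2 _ (fS (t - 1) i hi) (t - 1) (by omega)
    rwa [hfp i hi] at this
  have D1 : ∀ i i', i ≠ i' → ∀ v, core i v → jump i' v → False := by
    rintro i i' hii v ⟨hvP, hvc⟩ ⟨hi', x, hx, h | ⟨h, h'⟩ | h⟩
    · obtain ⟨h1, h2⟩ := F1 _ (fS x i' hi') x hx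
      rw [← h] at h1 h2
      have hj : i = f^[x] i' := huniq hvP h2
      have hiS : i ∈ S := hj ▸ fS x i' hi'
      rw [← hj] at h
      have hx0 : 0 < x := by
        rcases Nat.eq_zero_or_pos x with h0 | h0
        · subst h0
          exact absurd hj hii
        · exact h0
      rcases hvc hiS with h3 | h3
      · have := F3 i hiS 0 x hx0 hx
        rw [← h] at this
        omega
      · have := hBA i v h1 hvP _ (F2i i hiS).1.1 (F2i i hiS).1.2 (F2i i hiS).2
        omega
    · exact h' (hsup hvP)
    · obtain ⟨h1, h2⟩ := F2 _ (fS x i' hi') x hx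
      rw [← h] at h1 h2
      have hj : i = f (f^[x] i') := huniq hvP h2
      have hiS : i ∈ S := hj ▸ hfS _ (fS x i' hi')
      have hxt : x + 1 ≠ t := by
        intro h0
        apply hii
        rw [hj, ← Function.iterate_succ_apply' f x i', Nat.succ_eq_add_one, h0]
        exact hft i' hi'
      have hp : f^[t - 1] i = f^[x] i' :=
        finj _ (fS _ i hiS) _ (fS _ i' hi') ((hfp i hiS).trans hj)
      rcases hvc hiS with h3 | h3
      · have := hBA i _ (F1 i hiS 0 (by omega)).1 (F1 i hiS 0 (by omega)).2 v h1.1 h1.2 hvP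
        omega
      · have := F4 _ (fS x i' hi') x (t - 1) (by omega) (by omega)
        rw [← h, ← hj, ← hp] at this
        omega
  have D2 : ∀ i i', i ≠ i' → ∀ v, jump i v → jump i' v → False := by
    rintro i i' hii v ⟨hi, x, hx, h⟩ ⟨hi', x', hx', h'⟩
    have hj := fS x i hi
    have hj' := fS x' i' hi'
    have hdiff : ¬ (f^[x] i = f^[x'] i' ∧ x = x') := by
      rintro ⟨h1, rfl⟩
      exact hii (fninj x i hi i' hi' h1)
    have B1 := F1 _ hj x hx
    have B1' := F1 _ hj' x' hx'
    have A1 := F2 _ hj x hx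
    have A1' := F2 _ hj' x' hx'
    rcases h with h | ⟨h, hn⟩ | h
    · rw [← h] at B1
      rcases h' with h' | ⟨h', hn'⟩ | h'
      · rw [← h'] at B1'
        have hjj := huniq B1.2 B1'.2
        refine hdiff ⟨hjj, F3' _ hj x hx x' hx' ?_⟩
        rw [← h, h', hjj]
      · exact hn' (hsup B1.2)
      · rw [← h'] at A1'
        exact A1'.1.2 B1.1
    · rcases h' with h' | ⟨h', hn'⟩ | h'
      · rw [← h'] at B1'
        exact hn (hsup B1'.2)
      · exact hdiff (F6 _ hj _ hj' x hx x' hx' (h ▸ h'))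
      · rw [← h'] at A1'
        exact hn (hsup A1'.2)
    · rw [← h] at A1
      rcases h' with h' | ⟨h', hn'⟩ | h'
      · rw [← h'] at B1'
        exact A1.1.2 B1'.1
      · exact hn' (hsup A1.2)
      · rw [← h'] at A1'
        have hjj := finj _ hj _ hj' (huniq A1.2 A1'.2)
        refine hdiff ⟨hjj, F4' _ hj x hx x' hx' ?_⟩
        rw [← h, h', hjj]
  have hlastle : ∀ i, ∀ v ∈ (L i).support, posOn (L i) v ≤ posOn (L i) (L i).last :=
    fun i v hv => posOn_le_last _ hv
  have hmin := min_reach hL W ?_ ?_ ?_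
  · -- counting
    let Lost : Finset V := (S ×ˢ Finset.range (k + 1)).image (fun p => e p.1 p.2)
    let Mid : Finset V := (S ×ˢ Finset.range t).image (fun p => gg p.1 p.2)
    have hLc : Lost.card = S.card * (k + 1) := by
      rw [Finset.card_image_of_injOn]
      · simp
      · rintro ⟨j, y⟩ hp ⟨j', y'⟩ hp' h
        simp at hp hp' h
        have h1 := E1 j hp.1 y (by omega)
        have h2 := E1 j' hp'.1 y' (by omega)
        rw [← h] at h2
        have := huniq h1.2 h2.2
        subst this
        rw [E3 j hp.1 y (by omega) y' (by omega) h]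
    have hMc : Mid.card ≤ S.card * t := by
      refine Finset.card_image_le.trans ?_
      simp
    have hLs : (Lost : Set V) ⊆ linkSupport L := by
      intro v hv
      simp only [Lost, Finset.coe_image, Set.mem_image] at hv
      obtain ⟨⟨j, y⟩, hp, rfl⟩ := hv
      simp at hp
      exact hsup (E1 j hp.1 y (by omega)).2
    have hsub : (⋃ i, W i) ⊆ (linkSupport L \ Lost) ∪ Mid := by
      intro v hv
      obtain ⟨i, hv⟩ := Set.mem_iUnion.1 hv
      by_cases hvL : v ∈ linkSupport L
      · refine Or.inl ⟨hvL, fun hvl => ?_⟩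
        simp only [Lost, Finset.coe_image, Set.mem_image] at hvl
        obtain ⟨⟨j, y⟩, hp, hev⟩ := hvl
        simp at hp hev
        obtain ⟨hj, hy⟩ := hp
        obtain ⟨h1, h2⟩ := E1 j hj y (by omega)
        rw [hev] at h1 h2
        rcases hv with ⟨hvP, hvc⟩ | ⟨hi, x, hx, h | ⟨h, h'⟩ | h⟩
        · have hij := huniq hvP h2
          subst hij
          rcases hvc hj with h3 | h3
          · have := E2 i hj 0 (by omega) y (by omega)
            rw [hev] at this
            omega
          · have := hBA i v h1 hvP _ (F2i i hj).1.1 (F2i i hj).1.2 (F2i i hj).2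
            omega
        · have h3 := F1 _ (fS x i hi) x hx
          rw [← h] at h3
          have hij := huniq h3.2 h2
          have := E2 j hj x hx y (by omega)
          rw [hev, ← hij, ← h] at this
          omega
        · exact h' hvL
        · have h3 := F2 _ (fS x i hi) x hx
          rw [← h] at h3
          exact h3.1.2 h1
      · rcases hv with ⟨hvP, hvc⟩ | ⟨hi, x, hx, h | ⟨h, h'⟩ | h⟩
        · exact absurd (hsup hvP) hvL
        · exact absurd (hsup (F1 _ (fS x i hi) x hx).2) (h ▸ hvL)
        · refine Or.inr ?_
          simp only [Mid, Finset.coe_image, Set.mem_image]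
          exact ⟨(f^[x] i, x), by simp [fS x i hi, hx], h.symm⟩
        · exact absurd (hsup (F2 _ (fS x i hi) x hx).2) (h ▸ hvL)
    have h1 := Set.ncard_le_ncard hsub (Set.toFinite _)
    have h2 := Set.ncard_union_le (linkSupport L \ (Lost : Set V)) (Mid : Set V)
    have h3 := Set.ncard_sdiff_add_ncard_of_subset hLs (Set.toFinite _)
    rw [Set.ncard_coe_finset] at h2 h3
    have h4 : 0 < S.card := hSne.card_pos
    have h5 : S.card * t < S.card * (k + 1) := Nat.mul_lt_mul_of_pos_left (by omega) h4
    omega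
  · rintro i j hij v (hv | hv) (hv' | hv')
    · exact hij (huniq hv.1 hv'.1)
    · exact D1 i j hij v hv hv'
    · exact D1 j i hij.symm v hv' hv
    · exact D2 i j hij v hv hv'
  · intro i
    exact Or.inl ⟨last_mem _, fun hi => Or.inr (hlastle i _ (F2i i hi).2)⟩
  · intro i
    by_cases hi : i ∈ S
    · have hbW : ∀ x < t, bb (f^[x] i) x ∈ W i := fun x hx => Or.inr ⟨hi, x, hx, Or.inl rfl⟩
      have haW : ∀ x < t, aa (f^[x] i) x ∈ W i :=
        fun x hx => Or.inr ⟨hi, x, hx, Or.inr (Or.inr rfl)⟩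
      have hJ : ∀ x < t, ReachIn G (W i) (bb (f^[x] i) x) (aa (f^[x] i) x) := by
        intro x hx
        rcases F5 _ (fS x i hi) x hx with ⟨-, h⟩ | ⟨h1, h2, h3⟩
        · exact Relation.ReflTransGen.single ⟨h, hbW x hx, haW x hx⟩
        · have hgW : gg (f^[x] i) x ∈ W i := Or.inr ⟨hi, x, hx, Or.inr (Or.inl ⟨rfl, h1⟩)⟩
          exact Relation.ReflTransGen.head ⟨h2, hbW x hx, hgW⟩
            (Relation.ReflTransGen.single ⟨h3, hgW, haW x hx⟩)
      have hall : ∀ x < t, ReachIn G (W i) (bb i 0) (aa (f^[x] i) x) := by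
        intro x
        induction x with
        | zero => intro hx; exact hJ 0 hx
        | succ x ih =>
          intro hx
          refine Relation.ReflTransGen.trans (Relation.ReflTransGen.tail (ih (by omega)) ?_)
            (hJ (x + 1) hx)
          refine ⟨?_, haW x (by omega), hbW (x + 1) hx⟩
          have hj := fS (x + 1) i hi
          have hA := F2 _ (fS x i hi) x (by omega)
          have hB := F1 _ hj (x + 1) hx
          rw [← Function.iterate_succ_apply' f x i] at hA
          have hE1 := E1 _ hj 0 (by omega)
          have hE2 := E2 _ hj (x + 1) hx 0 (by omega)
          have hE3 := hBA _ _ hE1.1 hE1.2 _ hA.1.1 hA.1.2 hA.2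
          have hne : aa (f^[x] i) x ≠ bb (f^[x + 1] i) (x + 1) := by
            intro h
            exact hA.1.2 (h ▸ hB.1)
          refine (hC _ hA.1.1 _ (hBC hB.1) hne).resolve_right ?_
          exact no_shortcut hL (f^[x + 1] i) hB.2 hA.2 (by
            omega)
      have hb0 := F1 i hi 0 (by omega)
      refine Relation.ReflTransGen.trans (b := bb i 0) ?_ (Relation.ReflTransGen.trans
        (hall (t - 1) (by omega)) ?_)
      · apply reach_seg (L i) (first_mem _) hb0.2 (by rw [posOn_first]; omega)
        intro w hw _ h
        exact Or.inl ⟨hw, fun _ => Or.inl h⟩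
      · apply reach_seg (L i) (F2i i hi).2 (last_mem _) (hlastle i _ (F2i i hi).2)
        intro w hw h _
        exact Or.inl ⟨hw, fun _ => Or.inr h⟩
    · apply reach_seg (L i) (first_mem _) (last_mem _) (by rw [posOn_first]; omega)
      intro w hw _ _
      exact Or.inl ⟨hw, fun h => absurd h hi⟩

/-- Theorem 3.1: if `B ⊆ V(L)` is `C`-acceptable for a minimum linkage `L` and
`B ≠ (V(L) ∩ C) ∖ {t 1,…,t k}`, then some vertex `v ∈ (V(L) ∩ C) ∖ (B ∪ {t 1,…,t k})`
can be added keeping `C`-acceptability. -/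
theorem c_acceptable_augment {V : Type} [Fintype V] {k : ℕ} (G : Dgraph V)
    (sv tv : Fin k → V) (hinst : IsInstance sv tv)
    (L : Fin k → Dpath G) (hL : IsMinimumLinkageFor L sv tv)
    (C : Set V) (hC : G.IsClique C)
    (B : Set V) (hBL : B ⊆ linkSupport L)
    (hacc : CAcceptable sv tv L C B)
    (hne : B ≠ (linkSupport L ∩ C) \ Set.range tv) :
    ∃ v ∈ (linkSupport L ∩ C) \ (B ∪ Set.range tv),
      CAcceptable sv tv L C (insert v B) := by
  by_contra hcon
  push Not at hcon
  obtain ⟨hBC, hs, ht, hini, hmat⟩ := id hacc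
  have hBA : ∀ i, ∀ b ∈ B, b ∈ (L i).support → ∀ a ∈ C, a ∉ B → a ∈ (L i).support →
      posOn (L i) b < posOn (L i) a := by
    intro i b hb hbP a ha haB haP
    obtain ⟨Q, hQ, hQC⟩ := hini i
    exact before_of_initial hBC hQ hQC hb hbP ha haB haP
  have hsub : B ⊆ (linkSupport L ∩ C) \ Set.range tv := by
    intro v hv
    refine ⟨⟨hBL hv, hBC hv⟩, fun h => ?_⟩
    have : v ∈ Set.range tv ∩ B := ⟨h, hv⟩
    rw [ht] at this
    exact this
  have hex : ∃ v ∈ (linkSupport L ∩ C) \ Set.range tv, v ∉ B := by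
    by_contra h
    push Not at h
    exact hne (Set.Subset.antisymm hsub h)
  obtain ⟨v, ⟨⟨hvL, hvC⟩, hvt⟩, hvB⟩ := hex
  obtain ⟨i0, hi0⟩ := Set.mem_iUnion.1 hvL
  have h0 : ∃ v ∈ (L i0).support, v ∈ C ∧ v ∉ B ∧ v ≠ (L i0).last :=
    ⟨v, hi0, hvC, hvB, fun h => hvt ⟨i0, by rw [← (hL.1.2 i0).2, h]⟩⟩
  have hall : ∀ i : Fin k, ∃ (j : Fin k) (b g a : ℕ → V),
      (∃ v ∈ (L i).support, v ∈ C ∧ v ∉ B ∧ v ≠ (L i).last) →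
      (∃ v ∈ (L j).support, v ∈ C ∧ v ∉ B ∧ v ≠ (L j).last) ∧
      MatchData L C B (k ^ 2 + k + 1) i j b g a := by
    intro i
    by_cases hi : ∃ v ∈ (L i).support, v ∈ C ∧ v ∉ B ∧ v ≠ (L i).last
    · obtain ⟨j, b, g, a, h⟩ := extract_matching G sv tv L hL.1 C B hacc hcon i hi
      exact ⟨j, b, g, a, fun _ => h⟩
    · exact ⟨i, fun _ => v, fun _ => v, fun _ => v, fun h => absurd h hi⟩
  choose f b g a hf using hall
  obtain ⟨S, t, ht1, htk, hSne, hSp, hfS, hft⟩ := exists_cycle f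
    (fun i => ∃ v ∈ (L i).support, v ∈ C ∧ v ∉ B ∧ v ≠ (L i).last)
    (fun i hi => (hf i hi).1) i0 h0
  exact no_cycle hL.2 C B hC hBC hBA f b g a S t ht1 htk hSne hfS hft
    (fun i hi => (hf i (hSp i hi)).2)
end

section
/- Let k,c≥1 and z=c(c(k²+k+1)+k+2). Let (G,s_1,t_1,…,s_k,t_k) be a problem instance where G has a clique-partition (C_1,…,C_c), and let L=(P_1,…,P_k) be a minimum linkage for it. Let B⊆V(L) be acceptable, with B≠V(L)∖{t_1,…,t_k}. Then there exists v∈V(L)∖(B∪{t_1,…,t_k}) such that B∪{v} is acceptable. -/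
open scoped Classical

namespace AA

variable {V : Type} {G : Dgraph V}

noncomputable def pos (P : Dpath G) (v : V) : ℕ := P.verts.idxOf v

theorem pos_lt {P : Dpath G} {v : V} (h : v ∈ P.verts) : pos P v < P.verts.length :=
  List.idxOf_lt_length_iff.2 h

theorem pos_getElem {P : Dpath G} {n : ℕ} (h : n < P.verts.length) : pos P P.verts[n] = n :=
  P.nodup.idxOf_getElem n h

theorem getElem_pos {P : Dpath G} {v : V} (h : v ∈ P.verts) : P.verts[pos P v]'(pos_lt h) = v :=
  List.getElem_idxOf (pos_lt h)

theorem pos_inj {P : Dpath G} {u v : V} (hu : u ∈ P.verts) (hv : v ∈ P.verts)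
    (h : pos P u = pos P v) : u = v := by
  rw [← getElem_pos hu, ← getElem_pos hv]; simp [h]

theorem adj_of_pos {P : Dpath G} {u v : V} (hu : u ∈ P.verts) (hv : v ∈ P.verts)
    (h : pos P v = pos P u + 1) : G.adj u v := by
  have hc := P.chain
  have h1 := pos_lt hv
  have := List.isChain_iff_getElem.1 hc (pos P u) (by omega)
  rw [getElem_pos hu] at this
  have h2 : P.verts[pos P u + 1]'(by omega) = v := by
    have h3 := getElem_pos hv
    simpa only [h] using h3
  rwa [h2] at this

theorem first_mem (P : Dpath G) : P.first ∈ P.verts := List.head_mem _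
theorem last_mem (P : Dpath G) : P.last ∈ P.verts := List.getLast_mem _

theorem pos_first (P : Dpath G) : pos P P.first = 0 := by
  have h : 0 < P.verts.length := List.length_pos_of_ne_nil P.ne
  have : P.first = P.verts[0] := by simp [Dpath.first, List.head_eq_getElem]
  rw [this, pos_getElem]

theorem pos_last (P : Dpath G) : pos P P.last = P.verts.length - 1 := by
  have h : 0 < P.verts.length := List.length_pos_of_ne_nil P.ne
  have : P.last = P.verts[P.verts.length - 1] := by simp [Dpath.last, List.getLast_eq_getElem]
  rw [this, pos_getElem]

theorem pos_le_last {P : Dpath G} {v : V} (h : v ∈ P.verts) : pos P v ≤ pos P P.last := by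
  have := pos_lt h; rw [pos_last]; omega

theorem sublist_iff (P : Dpath G) (l : List V) :
    l.Sublist P.verts ↔ (∀ x ∈ l, x ∈ P.verts) ∧ l.Pairwise (fun u v => pos P u < pos P v) := by
  have hP : P.verts.Pairwise (fun u v => pos P u < pos P v) := by
    rw [List.pairwise_iff_getElem]
    intro i j hi hj hij
    rwa [pos_getElem, pos_getElem]
  constructor
  · intro h
    exact ⟨fun x hx => h.subset hx, hP.sublist h⟩
  · rintro ⟨h1, h2⟩
    have hn : l.Nodup := h2.imp (fun h e => by rw [e] at h; exact lt_irrefl _ h)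
    have : Std.Antisymm (fun u v => pos P u < pos P v) := ⟨fun a b h h' => absurd h (by omega)⟩
    exact List.sublist_of_subperm_of_pairwise (List.subperm_of_subset hn h1) h2 hP

theorem ofFn_sublist_iff (P : Dpath G) {n : ℕ} (g : Fin n → V) :
    (List.ofFn g).Sublist P.verts ↔
      (∀ j, g j ∈ P.verts) ∧ ∀ j j', j < j' → pos P (g j) < pos P (g j') := by
  rw [sublist_iff]
  simp [List.pairwise_ofFn, List.mem_ofFn]

/-- Reachability inside a set. -/
def Reach (G : Dgraph V) (W : Set V) (u v : V) : Prop :=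
  Relation.ReflTransGen (fun x y => G.adj x y ∧ x ∈ W ∧ y ∈ W) u v

theorem Reach.mono {W W' : Set V} (h : W ⊆ W') {u v : V} (hr : Reach G W u v) :
    Reach G W' u v := by
  have hm : (fun x y => G.adj x y ∧ x ∈ W ∧ y ∈ W) ≤ (fun x y => G.adj x y ∧ x ∈ W' ∧ y ∈ W') :=
    fun _ _ ⟨a, b, c⟩ => ⟨a, h b, h c⟩
  exact Relation.ReflTransGen.mono hm _ _ hr

theorem Reach.trans' {W : Set V} {u v w : V} (h : Reach G W u v) (h' : Reach G W v w) :
    Reach G W u w := Relation.ReflTransGen.trans h h'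

theorem Reach.edge {W : Set V} {u v : V} (h : G.adj u v) (hu : u ∈ W) (hv : v ∈ W) :
    Reach G W u v := Relation.ReflTransGen.single ⟨h, hu, hv⟩

theorem exists_path {W : Set V} {u v : V} (hv : v ∈ W) (h : Reach G W u v) :
    ∃ P : Dpath G, P.first = u ∧ P.last = v ∧ P.support ⊆ W := by
  induction h using Relation.ReflTransGen.head_induction_on with
  | refl => 
    exact ⟨⟨[v], by simp, by simp, by simp [List.Chain']⟩, by simp [Dpath.first], by simp [Dpath.last],
      by intro x hx; simp [Dpath.support] at hx; rwa [hx]⟩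
  | head hxy hr ih =>
    rename_i x y
    obtain ⟨P, h1, h2, h3⟩ := ih
    by_cases hx : x ∈ P.verts
    · obtain ⟨l1, l2, hl⟩ := List.append_of_mem hx
      refine ⟨⟨x :: l2, by simp, ?_, ?_⟩, ?_, ?_, ?_⟩
      · have := P.nodup; rw [hl] at this; exact (List.nodup_append.1 this).2.1
      · have := P.chain; rw [hl] at this
        exact List.IsChain.suffix this (List.suffix_append _ _)
      · simp [Dpath.first]
      · rw [← h2]; simp [Dpath.last, hl]
      · intro z hz; apply h3; simp only [Dpath.support, Set.mem_setOf_eq] at hz ⊢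
        rw [hl]; exact List.mem_append_right _ hz
    · refine ⟨⟨x :: P.verts, by simp, ?_, ?_⟩, ?_, ?_, ?_⟩
      · exact List.nodup_cons.2 ⟨hx, P.nodup⟩
      · have hc := P.chain
        have hne := P.ne
        simp only [Dpath.first] at h1
        show List.IsChain _ _
        rw [List.isChain_cons]
        refine ⟨?_, hc⟩
        intro z hz
        rw [List.head?_eq_some_head hne] at hz
        simp at hz
        rw [← hz, h1]; exact hxy.1
      · simp [Dpath.first]
      · rw [← h2]; simp [Dpath.last, List.getLast_cons P.ne]
      · intro z hz; simp only [Dpath.support, Set.mem_setOf_eq, List.mem_cons] at hz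
        rcases hz with rfl | hz
        · exact hxy.2.1
        · exact h3 hz

theorem reach_along {P : Dpath G} {u v : V} (hu : u ∈ P.verts) (hv : v ∈ P.verts)
    (h : pos P u ≤ pos P v) :
    Reach G {x | x ∈ P.verts ∧ pos P u ≤ pos P x ∧ pos P x ≤ pos P v} u v := by
  obtain ⟨d, hd⟩ := Nat.exists_eq_add_of_le h
  induction d generalizing v with
  | zero => rw [pos_inj hu hv (by omega)]; exact Relation.ReflTransGen.refl
  | succ d ih =>
    have hl := pos_lt hv
    have hw : P.verts[pos P u + d]'(by omega) ∈ P.verts := List.getElem_mem _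
    have hp : pos P (P.verts[pos P u + d]'(by omega)) = pos P u + d := pos_getElem _
    refine Reach.trans' ((ih hw (by omega) hp).mono ?_) (Reach.edge (adj_of_pos hw hv (by omega)) ?_ ?_)
    · intro x hx; simp only [Set.mem_setOf_eq] at hx ⊢; exact ⟨hx.1, hx.2.1, by omega⟩
    · exact ⟨hw, by omega, by omega⟩
    · exact ⟨hv, by omega, by omega⟩

theorem min_le [Fintype V] {k : ℕ} {L : Fin k → Dpath G} (hL : IsMinimumLinkage L)
    (W : Fin k → Set V) (hd : ∀ i j, i ≠ j → Disjoint (W i) (W j))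
    (hW : ∀ i, (L i).last ∈ W i) (hr : ∀ i, Reach G (W i) (L i).first (L i).last) :
    (linkSupport L).ncard ≤ (⋃ i, W i).ncard := by
  choose P h1 h2 h3 using fun i => exists_path (hW i) (hr i)
  refine (hL.2 P ?_ (fun i => ⟨h1 i, h2 i⟩)).trans ?_
  · intro i j hij
    exact (hd i j hij).mono (h3 i) (h3 j)
  · apply Set.ncard_le_ncard _ (Set.toFinite _)
    exact Set.iUnion_mono h3

theorem col_unique {k : ℕ} {L : Fin k → Dpath G} (hL : IsLinkage L) {i j : Fin k} {v : V}
    (hi : v ∈ (L i).verts) (hj : v ∈ (L j).verts) : i = j := by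
  by_contra h
  exact Set.disjoint_left.1 (hL i j h) hi hj

/-- General rerouting lemma. -/
theorem reroute [Fintype V] {k : ℕ} {L : Fin k → Dpath G} (hL : IsMinimumLinkage L)
    {S : Type} (f : S → S) (htr : ∀ a b, ∃ T, f^[T] a = b)
    (act : Fin k → Prop) (d e : Fin k → S)
    (s t : S → Fin k → V) (I : S → Fin k → Set V)
    (hs : ∀ a i, act i → s a i ∈ I a i) (ht : ∀ a i, act i → t a i ∈ I a i)
    (hI : ∀ a i, act i → Reach G (I a i) (s a i) (t a i))
    (hjump : ∀ a i, act i → G.adj (t a i) (s (f a) i))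
    (hdisj : ∀ a i b j, act i → act j → i ≠ j → Disjoint (I a i) (I b j))
    (hact : ∀ a j, act j → ∀ i, ∀ v ∈ I a j, v ∈ (L i).verts → act i)
    (hsd : ∀ i, act i → s (d i) i ∈ (L i).verts)
    (hte : ∀ i, act i → t (e i) i ∈ (L i).verts)
    (hd : ∀ i, act i → ∀ a j, act j → j ≠ i → ∀ v ∈ I a j, v ∈ (L i).verts →
      pos (L i) (s (d i) i) < pos (L i) v)
    (he : ∀ i, act i → ∀ a j, act j → j ≠ i → ∀ v ∈ I a j, v ∈ (L i).verts →
      pos (L i) v < pos (L i) (t (e i) i))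
    (X Y : Set V)
    (hX : ∀ v ∈ X, ∃ i, act i ∧ v ∈ (L i).verts ∧ pos (L i) (s (d i) i) < pos (L i) v ∧
      pos (L i) v < pos (L i) (t (e i) i))
    (hXI : ∀ v ∈ X, ∀ a j, act j → v ∉ I a j)
    (hY : ∀ a i, act i → I a i ⊆ linkSupport L ∪ Y)
    (hXY : Y.ncard < X.ncard) : False := by
  let Wa : Fin k → Set V := fun i =>
    {v | v ∈ (L i).verts ∧ pos (L i) v ≤ pos (L i) (s (d i) i)} ∪ (⋃ a, I a i) ∪
      {v | v ∈ (L i).verts ∧ pos (L i) (t (e i) i) ≤ pos (L i) v}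
  let W : Fin k → Set V := fun i => if act i then Wa i else (L i).support
  have hWa : ∀ i, act i → W i = Wa i := fun i h => if_pos h
  have hWn : ∀ i, ¬ act i → W i = (L i).support := fun i h => if_neg h
  have hlast : ∀ i, (L i).last ∈ W i := by
    intro i
    by_cases h : act i
    · rw [hWa i h]
      exact Or.inr ⟨last_mem _, pos_le_last (hte i h)⟩
    · rw [hWn i h]; exact last_mem _
  have hreach : ∀ i, Reach G (W i) (L i).first (L i).last := by
    intro i
    by_cases h : act i
    · rw [hWa i h]
      have h1 : Reach G (Wa i) (L i).first (s (d i) i) := by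
        refine (reach_along (first_mem _) (hsd i h) (by rw [pos_first]; omega)).mono ?_
        intro x hx; exact Or.inl (Or.inl ⟨hx.1, hx.2.2⟩)
      have h3 : Reach G (Wa i) (t (e i) i) (L i).last := by
        refine (reach_along (hte i h) (last_mem _) (pos_le_last (hte i h))).mono ?_
        intro x hx; exact Or.inr ⟨hx.1, hx.2.1⟩
      have hIW : ∀ a, I a i ⊆ Wa i := fun a x hx => Or.inl (Or.inr (Set.mem_iUnion.2 ⟨a, hx⟩))
      have h2 : ∀ T a, Reach G (Wa i) (s a i) (t (f^[T] a) i) := by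
        intro T
        induction T with
        | zero => intro a; exact (hI a i h).mono (hIW a)
        | succ T ih =>
          intro a
          refine ((hI a i h).mono (hIW a)).trans' (Reach.trans' (Reach.edge (hjump a i h) (hIW _ (ht a i h)) (hIW _ (hs _ i h))) ?_)
          exact ih (f a)
      obtain ⟨T, hT⟩ := htr (d i) (e i)
      have := h2 T (d i)
      rw [hT] at this
      exact h1.trans' (this.trans' h3)
    · rw [hWn i h]
      refine (reach_along (first_mem _) (last_mem _) (by rw [pos_first]; omega)).mono ?_
      intro x hx; exact hx.1
  have hLd := hL.1
  have key : ∀ i j, act i → i ≠ j → ∀ v, v ∈ W i → v ∈ W j → False := by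
    intro i j hi hij v hv hv'
    rw [hWa i hi] at hv
    by_cases hj : act j
    · rw [hWa j hj] at hv'
      rcases hv with (hv | hv) | hv <;> rcases hv' with (hv' | hv') | hv'
      · exact hij (col_unique hLd hv.1 hv'.1)
      · obtain ⟨a, ha⟩ := Set.mem_iUnion.1 hv'
        have := hd i hi a j hj hij.symm v ha hv.1
        have := hv.2; omega
      · exact hij (col_unique hLd hv.1 hv'.1)
      · obtain ⟨a, ha⟩ := Set.mem_iUnion.1 hv
        have := hd j hj a i hi hij v ha hv'.1
        have := hv'.2; omega
      · obtain ⟨a, ha⟩ := Set.mem_iUnion.1 hv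
        obtain ⟨b, hb⟩ := Set.mem_iUnion.1 hv'
        exact Set.disjoint_left.1 (hdisj a i b j hi hj hij) ha hb
      · obtain ⟨a, ha⟩ := Set.mem_iUnion.1 hv
        have := he j hj a i hi hij v ha hv'.1
        have := hv'.2; omega
      · exact hij (col_unique hLd hv.1 hv'.1)
      · obtain ⟨a, ha⟩ := Set.mem_iUnion.1 hv'
        have := he i hi a j hj hij.symm v ha hv.1
        have := hv.2; omega
      · exact hij (col_unique hLd hv.1 hv'.1)
    · rw [hWn j hj] at hv'
      rcases hv with (hv | hv) | hv
      · exact hij (col_unique hLd hv.1 hv')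
      · obtain ⟨a, ha⟩ := Set.mem_iUnion.1 hv
        exact hj (hact a i hi j v ha hv')
      · exact hij (col_unique hLd hv.1 hv')
  have hdW : ∀ i j, i ≠ j → Disjoint (W i) (W j) := by
    intro i j hij
    rw [Set.disjoint_left]
    intro v hv hv'
    by_cases hi : act i
    · exact key i j hi hij v hv hv'
    · by_cases hj : act j
      · exact key j i hj hij.symm v hv' hv
      · rw [hWn _ hi] at hv; rw [hWn _ hj] at hv'
        exact hij (col_unique hLd hv hv')
  have hmin := min_le hL W hdW hlast hreach
  have hsub : (⋃ i, W i) ⊆ (linkSupport L \ X) ∪ Y := by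
    intro v hv
    obtain ⟨i, hi⟩ := Set.mem_iUnion.1 hv
    have hXn : ∀ j, v ∈ (L j).verts → (act j → (pos (L j) v ≤ pos (L j) (s (d j) j) ∨
        pos (L j) (t (e j) j) ≤ pos (L j) v)) → v ∉ X := by
      intro j hj hh hx
      obtain ⟨i', hi', h1, h2, h3⟩ := hX v hx
      obtain rfl := col_unique hLd hj h1
      have := hh hi'
      omega
    by_cases h : act i
    · rw [hWa i h] at hi
      rcases hi with (hv | hv) | hv
      · exact Or.inl ⟨Set.mem_iUnion.2 ⟨i, hv.1⟩, hXn i hv.1 fun _ => Or.inl hv.2⟩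
      · obtain ⟨a, ha⟩ := Set.mem_iUnion.1 hv
        rcases hY a i h ha with h' | h'
        · exact Or.inl ⟨h', fun hx => hXI v hx a i h ha⟩
        · exact Or.inr h'
      · exact Or.inl ⟨Set.mem_iUnion.2 ⟨i, hv.1⟩, hXn i hv.1 fun _ => Or.inr hv.2⟩
    · rw [hWn i h] at hi
      exact Or.inl ⟨Set.mem_iUnion.2 ⟨i, hi⟩, hXn i hi fun h' => absurd h' h⟩
  have hXL : X ⊆ linkSupport L := by
    intro v hv
    obtain ⟨i, _, h1, _⟩ := hX v hv
    exact Set.mem_iUnion.2 ⟨i, h1⟩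
  have h1 := Set.ncard_le_ncard hsub (Set.toFinite _)
  have h2 := Set.ncard_union_le (linkSupport L \ X) Y
  have h3 := Set.ncard_diff_add_ncard_of_subset hXL (Set.toFinite _)
  omega

/-- No shortcut, hence backward edges in cliques. -/
theorem back_edge [Fintype V] {k : ℕ} {L : Fin k → Dpath G} (hL : IsMinimumLinkage L)
    {C : Set V} (hC : G.IsClique C) {i : Fin k} {u v : V} (hu : u ∈ (L i).verts)
    (hv : v ∈ (L i).verts) (huC : u ∈ C) (hvC : v ∈ C) (h : pos (L i) u + 2 ≤ pos (L i) v) :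
    G.adj v u := by
  have hne : u ≠ v := by rintro rfl; omega
  rcases hC u huC v hvC hne with hadj | hadj
  swap
  · exact hadj
  exfalso
  have hl := pos_lt hv
  let w := (L i).verts[pos (L i) u + 1]'(by omega)
  have hw : w ∈ (L i).verts := List.getElem_mem _
  have hpw : pos (L i) w = pos (L i) u + 1 := pos_getElem _
  let W : Fin k → Set V := fun j => if j = i then (L i).support \ {w} else (L j).support
  have hWs : ∀ j, W j ⊆ (L j).support := by
    intro j x hx
    by_cases h : j = i
    · subst h; simp only [W, if_true] at hx; exact hx.1
    · simpa only [W, if_neg h] using hx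
  have hWi : W i = (L i).support \ {w} := if_pos rfl
  have hwlast : (L i).last ≠ w := by
    intro hh
    have := pos_le_last hv; rw [hh] at this; omega
  have hmin := min_le hL W (fun a b hab => (hL.1 a b hab).mono (hWs a) (hWs b)) ?_ ?_
  · have hsub : (⋃ j, W j) ⊆ linkSupport L \ {w} := by
      intro x hx
      obtain ⟨j, hj⟩ := Set.mem_iUnion.1 hx
      refine ⟨Set.mem_iUnion.2 ⟨j, hWs j hj⟩, ?_⟩
      rintro rfl
      obtain rfl := col_unique hL.1 hw (hWs j hj)
      rw [hWi] at hj
      exact hj.2 rfl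
    have h1 := Set.ncard_le_ncard hsub (Set.toFinite _)
    have h2 := Set.ncard_diff_singleton_lt_of_mem (s := linkSupport L) (a := w) (Set.mem_iUnion.2 ⟨i, hw⟩) (Set.toFinite _)
    omega
  · intro j
    by_cases hji : j = i
    · subst hji; rw [hWi]
      exact ⟨last_mem _, hwlast⟩
    · simp only [W, if_neg hji]; exact last_mem _
  · intro j
    by_cases hji : j = i
    · subst hji; rw [hWi]
      refine Reach.trans' ((reach_along (first_mem _) hu (by rw [pos_first]; omega)).mono ?_)
        (Reach.trans' (Reach.edge hadj ⟨hu, ?_⟩ ⟨hv, ?_⟩)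
        ((reach_along hv (last_mem _) (pos_le_last hv)).mono ?_))
      · intro x hx
        refine ⟨hx.1, ?_⟩
        rintro rfl
        have := hx.2.2; omega
      · intro h; rw [Set.mem_singleton_iff.1 h] at hpw; omega
      · intro hh; have hvw : v = w := hh
        rw [← hvw] at hpw; omega
      · intro x hx
        refine ⟨hx.1, ?_⟩
        rintro rfl
        have := hx.2.1; omega
    · simp only [W, if_neg hji]
      refine (reach_along (first_mem _) (last_mem _) (by rw [pos_first]; omega)).mono ?_
      intro x hx; exact hx.1


/-! Auxiliary combinatorial lemmas. -/

theorem exists_cycle {X : Type} [Finite X] (f : X → X) (U : Set X) (hne : U.Nonempty)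
    (hU : ∀ a ∈ U, f a ∈ U) :
    ∃ S : Set X, S ⊆ U ∧ S.Nonempty ∧ (∀ a ∈ S, f a ∈ S) ∧
      ∀ a ∈ S, ∀ b ∈ S, ∃ T, f^[T] a = b := by
  have hwf : ∃ S : Set X, (S ⊆ U ∧ S.Nonempty ∧ ∀ a ∈ S, f a ∈ S) ∧
      ∀ S' : Set X, (S' ⊆ U ∧ S'.Nonempty ∧ ∀ a ∈ S', f a ∈ S') → S.ncard ≤ S'.ncard := by
    obtain ⟨S, hS, hmin⟩ := Set.exists_min_image
      {S : Set X | S ⊆ U ∧ S.Nonempty ∧ ∀ a ∈ S, f a ∈ S} Set.ncard (Set.toFinite _)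
      ⟨U, subset_rfl, hne, hU⟩
    exact ⟨S, hS, hmin⟩
  obtain ⟨S, ⟨h1, h2, h3⟩, hmin⟩ := hwf
  refine ⟨S, h1, h2, h3, ?_⟩
  intro a ha b hb
  have hit : ∀ T, f^[T] a ∈ S := by
    intro T
    induction T with
    | zero => exact ha
    | succ T ih => rw [Function.iterate_succ_apply']; exact h3 _ ih
  let S' : Set X := Set.range fun T => f^[T] a
  have hS' : S' ⊆ S := by rintro _ ⟨T, rfl⟩; exact hit T
  have hle := hmin S' ⟨hS'.trans h1, ⟨a, 0, rfl⟩, by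
    rintro _ ⟨T, rfl⟩; exact ⟨T + 1, by simp [Function.iterate_succ_apply']⟩⟩
  have heq := Set.eq_of_subset_of_ncard_le hS' hle (Set.toFinite _)
  rw [← heq] at hb
  exact hb

theorem iterate_sub {X : Type} (f : X → X) (S : Set X)
    (F : S → S) (hF : ∀ a : S, (F a : X) = f a) (T : ℕ) (a : S) :
    ((F^[T] a : S) : X) = f^[T] (a : X) := by
  induction T generalizing a with
  | zero => rfl
  | succ T ih => rw [Function.iterate_succ_apply, Function.iterate_succ_apply, ih, hF]

theorem trans_bij {S : Type} [Finite S] (f : S → S) (htr : ∀ a b, ∃ T, f^[T] a = b) :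
    Function.Bijective f := by
  have hs : Function.Surjective f := by
    intro b
    obtain ⟨T, hT⟩ := htr (f b) b
    refine ⟨f^[T] b, ?_⟩
    rw [← Function.iterate_succ_apply' f T b, Function.iterate_succ_apply, hT]
  exact ⟨Finite.injective_iff_surjective.2 hs, hs⟩

theorem exists_perm {k : ℕ} (i i' : Fin k) (p q : Prop) (h : p → q → i ≠ i') :
    ∃ σ : Fin k ≃ Fin k, (p → (σ i : ℕ) = 0) ∧ (q → (σ i' : ℕ) = k - 1) := by
  have hk : 0 < k := i.pos
  let z : Fin k := ⟨0, hk⟩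
  let l : Fin k := ⟨k - 1, by omega⟩
  by_cases hp : p
  · by_cases hq : q
    · have hne := h hp hq
      let σ1 := Equiv.swap i z
      refine ⟨σ1.trans (Equiv.swap (σ1 i') l), fun _ => ?_, fun _ => ?_⟩
      · have h1 : σ1 i = z := Equiv.swap_apply_left _ _
        have h2 : σ1 i' ≠ z := by rw [← h1]; exact fun hh => hne (σ1.injective hh).symm
        have h3 : l ≠ z := by
          intro hh
          have : k - 1 = 0 := congrArg Fin.val hh
          apply hne; ext; omega
        rw [Equiv.trans_apply, h1, Equiv.swap_apply_of_ne_of_ne h2.symm h3.symm]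
      · rw [Equiv.trans_apply, Equiv.swap_apply_left]
    · exact ⟨Equiv.swap i z, fun _ => by rw [Equiv.swap_apply_left], fun h => absurd h hq⟩
  · exact ⟨Equiv.swap i' l, fun h => absurd h hp, fun _ => by rw [Equiv.swap_apply_left]⟩

theorem pick (Bad : Finset ℕ) (n k : ℕ) (h : Bad.card + k ≤ n) :
    ∃ g : Fin k → ℕ, StrictMono g ∧ (∀ x, g x < n) ∧ (∀ x, g x ∉ Bad) ∧
      ∀ x : Fin k, (x : ℕ) = 0 → g x ≤ Bad.card := by
  let Good := Finset.range n \ Bad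
  have hc : k ≤ Good.card := by
    have := Finset.le_card_sdiff Bad (Finset.range n)
    rw [Finset.card_range] at this
    show k ≤ (Finset.range n \ Bad).card
    omega
  have hmem : ∀ x : Fin k, Good.orderEmbOfFin rfl (Fin.castLE hc x) ∈ Good :=
    fun x => Finset.orderEmbOfFin_mem _ _ _
  refine ⟨fun x => Good.orderEmbOfFin rfl (Fin.castLE hc x), ?_, ?_, ?_, ?_⟩
  · intro x y hxy
    exact (Good.orderEmbOfFin rfl).strictMono (by simpa using hxy)
  · intro x; exact Finset.mem_range.1 (Finset.mem_sdiff.1 (hmem x)).1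
  · intro x; exact (Finset.mem_sdiff.1 (hmem x)).2
  · intro x hx
    have hsub : Finset.range (Good.orderEmbOfFin rfl (Fin.castLE hc x)) ⊆ Bad := by
      intro u hu
      by_contra hb
      have hu' := Finset.mem_range.1 hu
      have hlt := Finset.mem_range.1 (Finset.mem_sdiff.1 (hmem x)).1
      have hg : u ∈ Good := Finset.mem_sdiff.2 ⟨Finset.mem_range.2 (by omega), hb⟩
      have hr : u ∈ Set.range (Good.orderEmbOfFin rfl) := by
        rw [Finset.range_orderEmbOfFin]; exact hg
      obtain ⟨y, hy⟩ := hr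
      rw [← hy] at hu'
      have := (Good.orderEmbOfFin rfl).lt_iff_lt.1 hu'
      have h2 : (y : ℕ) < (x : ℕ) := this
      omega
    have := Finset.card_le_card hsub
    rwa [Finset.card_range] at this

theorem greedy [Fintype V] {S : Type} [Fintype S] (k n : ℕ) (hS : Fintype.card S ≤ k)
    (hn : n = k ^ 2 + k)
    (mid : S → ℕ → Set V) (hmid : ∀ a, ∀ u < n, (mid a u).ncard ≤ 1)
    (hd : ∀ a, ∀ u < n, ∀ v < n, u ≠ v → Disjoint (mid a u) (mid a v)) :
    ∃ g : S → Fin k → ℕ, (∀ a, StrictMono (g a)) ∧ (∀ a x, g a x < n) ∧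
      (∀ a, ∀ x : Fin k, (x : ℕ) = 0 → g a x ≤ k * (k - 1)) ∧
      ∀ a b, a ≠ b → ∀ x y, Disjoint (mid a (g a x)) (mid b (g b y)) := by
  have main : ∀ T : Finset S, ∃ g : S → Fin k → ℕ, (∀ a ∈ T, StrictMono (g a)) ∧
      (∀ a ∈ T, ∀ x, g a x < n) ∧ (∀ a ∈ T, ∀ x : Fin k, (x : ℕ) = 0 → g a x ≤ k * (k - 1)) ∧
      ∀ a ∈ T, ∀ b ∈ T, a ≠ b → ∀ x y, Disjoint (mid a (g a x)) (mid b (g b y)) := by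
    intro T
    induction T using Finset.induction_on with
    | empty => exact ⟨fun _ _ => 0, by simp, by simp, by simp, by simp⟩
    | insert a T ha ih =>
      obtain ⟨g, h1, h2, h3, h4⟩ := ih
      let Forb : Finset V := T.biUnion fun b => Finset.univ.biUnion fun x : Fin k =>
        (mid b (g b x)).toFinset
      have hTk : T.card + 1 ≤ k := by
        have := Finset.card_le_univ (insert a T)
        rw [Finset.card_insert_of_notMem ha] at this
        omega
      have hForb : Forb.card ≤ k * (k - 1) := by
        have hb : Forb.card ≤ T.card * k := by
          apply Finset.card_biUnion_le_card_mul
          intro b hb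
          refine (Finset.card_biUnion_le_card_mul _ _ 1 ?_).trans (by simp)
          intro x _
          rw [← Set.ncard_eq_toFinset_card']
          exact hmid b _ (h2 b hb x)
        calc Forb.card ≤ T.card * k := hb
          _ ≤ (k - 1) * k := Nat.mul_le_mul_right _ (by omega)
          _ = k * (k - 1) := Nat.mul_comm _ _
      let Bad : Finset ℕ := (Finset.range n).filter fun u => ∃ v ∈ Forb, v ∈ mid a u
      have hBad : Bad.card ≤ Forb.card := by
        have hw : ∀ u ∈ Bad, ∃ v, v ∈ Forb ∧ v ∈ mid a u := by
          intro u hu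
          obtain ⟨v, hv⟩ := (Finset.mem_filter.1 hu).2
          exact ⟨v, hv⟩
        rcases Bad.eq_empty_or_nonempty with hemp | ⟨u0, hu0⟩
        · rw [hemp]; simp
        have hVne : Nonempty V := ⟨(hw u0 hu0).choose⟩
        choose! w hw1 hw2 using hw
        refine Finset.card_le_card_of_injOn w hw1 ?_
        intro u hu u' hu' he
        by_contra hne
        have hlt := Finset.mem_range.1 (Finset.mem_filter.1 hu).1
        have hlt' := Finset.mem_range.1 (Finset.mem_filter.1 hu').1
        have e1 := hw2 u hu
        have e2 := hw2 u' hu'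
        rw [← he] at e2
        exact Set.disjoint_left.1 (hd a u hlt u' hlt' hne) e1 e2
      obtain ⟨γ, k1, k2, k3, k4⟩ := pick Bad n k (by
        have : k * (k - 1) + k ≤ n := by
          rw [hn]; obtain ⟨m, rfl⟩ : ∃ m, k = m + 1 := ⟨k - 1, by omega⟩
          simp only [Nat.add_sub_cancel]; nlinarith
        omega)
      have hγ : ∀ b ∈ T, ∀ x y, Disjoint (mid a (γ x)) (mid b (g b y)) := by
        intro b hb x y
        rw [Set.disjoint_left]
        intro v hv hv'
        apply k3 x
        refine Finset.mem_filter.2 ⟨Finset.mem_range.2 (k2 x), v, ?_, hv⟩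
        refine Finset.mem_biUnion.2 ⟨b, hb, Finset.mem_biUnion.2 ⟨y, Finset.mem_univ _, ?_⟩⟩
        simpa using hv'
      have hne : ∀ b ∈ T, b ≠ a := fun b hb he => ha (he ▸ hb)
      have ea : Function.update g a γ a = γ := Function.update_self _ _ _
      have eb : ∀ b ∈ T, Function.update g a γ b = g b := fun b hb =>
        Function.update_of_ne (hne b hb) _ _
      refine ⟨Function.update g a γ, ?_, ?_, ?_, ?_⟩
      · intro b hb
        rcases Finset.mem_insert.1 hb with rfl | hb
        · rw [ea]; exact k1
        · rw [eb b hb]; exact h1 b hb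
      · intro b hb
        rcases Finset.mem_insert.1 hb with rfl | hb
        · rw [ea]; exact k2
        · rw [eb b hb]; exact h2 b hb
      · intro b hb x hx
        rcases Finset.mem_insert.1 hb with rfl | hb
        · rw [ea]; have := k4 x hx; omega
        · rw [eb b hb]; exact h3 b hb x hx
      · intro b hb b' hb' hbb x y
        rcases Finset.mem_insert.1 hb with e1 | e1 <;>
          rcases Finset.mem_insert.1 hb' with e2 | e2
        · exact absurd (e1.trans e2.symm) hbb
        · rw [e1, ea, eb b' e2]; exact hγ b' e2 x y
        · rw [e2, ea, eb b e1]; exact (hγ b e1 y x).symm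
        · rw [eb b e1, eb b' e2]; exact h4 b e1 b' e2 hbb x y
  obtain ⟨g, h1, h2, h3, h4⟩ := main Finset.univ
  exact ⟨g, fun a => h1 a (Finset.mem_univ _), fun a => h2 a (Finset.mem_univ _),
    fun a => h3 a (Finset.mem_univ _), fun a b => h4 a (Finset.mem_univ _) b (Finset.mem_univ _)⟩

/-- `B` is initial inside `C` on every path. -/
theorem init_of_cacc {k : ℕ} {sv tv : Fin k → V} {L : Fin k → Dpath G} {C B : Set V}
    (h : CAcceptable sv tv L C B) {i : Fin k} {x y : V} (hx : x ∈ (L i).verts)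
    (hy : y ∈ (L i).verts) (hxC : x ∈ C) (hyB : y ∈ B) (hp : pos (L i) x ≤ pos (L i) y) :
    x ∈ B := by
  obtain ⟨hBC, _, _, hQ, _⟩ := h
  obtain ⟨Q, hQ1, hQ2⟩ := hQ i
  have hyQ : y ∈ Q.support ∩ C := by rw [hQ2]; exact ⟨hy, hyB⟩
  obtain ⟨l, hl⟩ := hQ1
  have hyQ' : y ∈ Q.verts := hyQ.1
  have hpy : pos (L i) y < Q.verts.length := by
    have : pos (L i) y = Q.verts.idxOf y := by
      rw [pos, ← hl]; exact List.idxOf_append_of_mem hyQ'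
    rw [this]; exact List.idxOf_lt_length_iff.2 hyQ'
  have hxQ : x ∈ Q.verts := by
    have h1 : Q.verts[pos (L i) x]'(by omega) = x := by
      have := getElem_pos hx
      simp only [← hl] at this
      rwa [List.getElem_append_left (by omega)] at this
    rw [← h1]; exact List.getElem_mem _
  have : x ∈ Q.support ∩ C := ⟨hxQ, hxC⟩
  rw [hQ2] at this
  exact this.2

theorem step1core [Fintype V] {k : ℕ} {L : Fin k → Dpath G} (hL : IsMinimumLinkage L)
    {C B : Set V} (hC : G.IsClique C) (hBC : B ⊆ C)
    {S : Type} [Fintype S] [Nonempty S] (f : S → S) (htr : ∀ a b, ∃ T, f^[T] a = b)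
    (col : S → Fin k) (hcol : Function.Injective col)
    (p : S → ℕ → Dpath G) (mid : S → ℕ → Set V) (n : ℕ) (hn : n = k ^ 2 + k) (r : S → V)
    (hdis : ∀ a, ∀ u < n, ∀ v < n, u ≠ v → Disjoint (p a u).support (p a v).support)
    (hmid1 : ∀ a, ∀ u < n, (mid a u).ncard ≤ 1)
    (hmid2 : ∀ a, ∀ u < n, ∀ v ∈ mid a u, v ∉ linkSupport L)
    (hmid3 : ∀ a, ∀ u < n, mid a u ⊆ (p a u).support)
    (hsup : ∀ a, ∀ u < n, ∀ v ∈ (p a u).support,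
      v = (p a u).first ∨ v = (p a u).last ∨ v ∈ mid a u)
    (hf : ∀ a, ∀ u < n, (p a u).first ∈ (L (col a)).verts)
    (hfB : ∀ a, ∀ u < n, (p a u).first ∈ B)
    (hfm : ∀ a, ∀ u < n, ∀ v < n, u < v →
      pos (L (col a)) (p a u).first < pos (L (col a)) (p a v).first)
    (hl : ∀ a, ∀ u < n, (p a u).last ∈ (L (col (f a))).verts)
    (hlB : ∀ a, ∀ u < n, (p a u).last ∈ C \ B)
    (hlm : ∀ a, ∀ u < n, ∀ v < n, u < v →
      pos (L (col (f a))) (p a u).last < pos (L (col (f a))) (p a v).last)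
    (hr : ∀ a, r a ∈ (L (col a)).verts) (hrB : ∀ a, r a ∉ B)
    (hfr : ∀ a, ∀ u < n, pos (L (col a)) (p a u).first < pos (L (col a)) (r a))
    (hrl : ∀ a, ∀ u < n, pos (L (col (f a))) (r (f a)) < pos (L (col (f a))) (p a u).last) :
    False := by
  have hcard : Fintype.card S ≤ k := by
    have := Fintype.card_le_of_injective col hcol
    simpa using this
  obtain ⟨hfi, hfs⟩ := trans_bij f htr
  obtain ⟨g, g1, g2, g3, g4⟩ := greedy k n hcard hn mid hmid1
    (fun a u hu v hv huv => (hdis a u hu v hv huv).mono (hmid3 a u hu) (hmid3 a v hv))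
  have hσ : ∀ a, ∃ σ : Fin k ≃ Fin k, (True → (σ (col a) : ℕ) = 0) ∧
      (f a ≠ a → (σ (col (f a)) : ℕ) = k - 1) := fun a =>
    exists_perm _ _ _ _ (fun _ h h' => h (hcol h').symm)
  choose σ hσ0 hσl using hσ
  have hσ0' := fun a => hσ0 a trivial
  let d : Fin k → S := Function.invFun col
  have hdc : ∀ a, d (col a) = a := Function.leftInverse_invFun hcol
  choose pr hpr using hfs
  have hlink : ∀ i v, v ∈ (L i).verts → v ∈ linkSupport L := fun i v h => Set.mem_iUnion.2 ⟨i, h⟩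
  have hk : 0 < k := (col (Classical.arbitrary S)).pos
  -- row abbreviations
  let R : S → Fin k → ℕ := fun a i => g a (σ a i)
  have hR : ∀ a i, R a i < n := fun a i => g2 a _
  have hRinj : ∀ a i j, R a i = R a j → i = j := fun a i j h => (σ a).injective ((g1 a).injective h)
  have hR0 : ∀ a i, i ≠ col a → R a (col a) < R a i := by
    intro a i hi
    apply g1 a
    show (σ a (col a) : ℕ) < (σ a i : ℕ)
    rw [hσ0' a]
    by_contra hh
    apply hi
    apply (σ a).injective
    ext
    rw [hσ0' a]; omega
  have hRl : ∀ a i, f a ≠ a → i ≠ col (f a) → R a i < R a (col (f a)) := by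
    intro a i ha hi
    apply g1 a
    show (σ a i : ℕ) < (σ a (col (f a)) : ℕ)
    rw [hσl a ha]
    by_contra hh
    apply hi
    apply (σ a).injective
    ext
    rw [hσl a ha]
    have := (σ a i).isLt
    omega
  let U : S → Finset ℕ := fun a =>
    (Finset.Ioo (R a (col a)) n) \ (Finset.univ.image (g a))
  have hRcol : ∀ a, R a (col a) ≤ k * (k - 1) := fun a => g3 a _ (hσ0' a)
  have hU : ∀ a, k ≤ (U a).card := by
    intro a
    have h1 : (U a) = (Finset.Ioo (R a (col a)) n) \
        ((Finset.univ.image (g a)).erase (R a (col a))) := by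
      ext u
      simp only [U, Finset.mem_sdiff, Finset.mem_Ioo, Finset.mem_erase]
      constructor
      · rintro ⟨h1, h2⟩; exact ⟨h1, fun h => h2 h.2⟩
      · rintro ⟨h1, h2⟩; exact ⟨h1, fun h => h2 ⟨by omega, h⟩⟩
    rw [h1]
    have h2 := Finset.le_card_sdiff ((Finset.univ.image (g a)).erase (R a (col a)))
      (Finset.Ioo (R a (col a)) n)
    rw [Finset.card_erase_of_mem (Finset.mem_image.2 ⟨_, Finset.mem_univ _, rfl⟩),
      Finset.card_image_of_injective _ (g1 a).injective, Nat.card_Ioo, Finset.card_univ,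
      Fintype.card_fin] at h2
    have h3 := hRcol a
    have h4 : k * (k - 1) + 2 * k = n := by
      rw [hn]; obtain ⟨m, rfl⟩ : ∃ m, k = m + 1 := ⟨k - 1, by omega⟩
      simp only [Nat.add_sub_cancel]; ring
    omega
  let Xa : S → Finset V := fun a => insert (r a) ((U a).image fun u => (p a u).first)
  have hUn : ∀ a, ∀ u ∈ U a, R a (col a) < u ∧ u < n ∧ ∀ x, g a x ≠ u := by
    intro a u hu
    have := Finset.mem_sdiff.1 hu
    refine ⟨(Finset.mem_Ioo.1 this.1).1, (Finset.mem_Ioo.1 this.1).2, fun x hx => this.2 ?_⟩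
    exact Finset.mem_image.2 ⟨x, Finset.mem_univ _, hx⟩
  have hfinj : ∀ a, ∀ u < n, ∀ v < n, (p a u).first = (p a v).first → u = v := by
    intro a u hu v hv h
    by_contra hne
    rcases Nat.lt_or_gt_of_ne hne with h' | h'
    · have := hfm a u hu v hv h'; rw [h] at this; omega
    · have := hfm a v hv u hu h'; rw [h] at this; omega
  have hXa : ∀ a, k + 1 ≤ (Xa a).card := by
    intro a
    rw [Finset.card_insert_of_notMem, Finset.card_image_of_injOn]
    · have := hU a; omega
    · intro u hu v hv h
      exact hfinj a u (hUn a u hu).2.1 v (hUn a v hv).2.1 h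
    · intro h
      obtain ⟨u, hu, he⟩ := Finset.mem_image.1 h
      exact hrB a (he ▸ hfB a u (hUn a u hu).2.1)
  have hXm : ∀ a, ∀ v ∈ Xa a, v = r a ∨ ∃ u, R a (col a) < u ∧ u < n ∧ (∀ x, g a x ≠ u) ∧
      v = (p a u).first := by
    intro a v hv
    rcases Finset.mem_insert.1 hv with h | h
    · exact Or.inl h
    · obtain ⟨u, hu, he⟩ := Finset.mem_image.1 h
      obtain ⟨h1, h2, h3⟩ := hUn a u hu
      exact Or.inr ⟨u, h1, h2, h3, he.symm⟩
  have hXp : ∀ a, ∀ v ∈ Xa a, v ∈ (L (col a)).verts := by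
    intro a v hv
    rcases hXm a v hv with rfl | ⟨u, _, hu, _, rfl⟩
    · exact hr a
    · exact hf a u hu
  let X : Finset V := Finset.univ.biUnion Xa
  have hXcard : (k + 1) * Fintype.card S ≤ X.card := by
    have : X.card = ∑ a, (Xa a).card := by
      apply Finset.card_biUnion
      intro a _ b _ hab
      show Disjoint (Xa a) (Xa b)
      rw [Finset.disjoint_left]
      intro v hv hv'
      exact hab (hcol (col_unique hL.1 (hXp a v hv) (hXp b v hv')))
    rw [this, Nat.mul_comm, ← smul_eq_mul]
    exact Finset.card_nsmul_le_sum _ _ _ (fun a _ => hXa a)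
  let Y : Finset V := Finset.univ.biUnion fun a : S => Finset.univ.biUnion fun i : Fin k =>
    (mid a (R a i)).toFinset
  have hYcard : Y.card ≤ Fintype.card S * k := by
    refine (Finset.card_biUnion_le_card_mul _ _ k ?_).trans (by simp)
    intro a _
    refine (Finset.card_biUnion_le_card_mul _ _ 1 ?_).trans (by simp)
    intro i _
    rw [← Set.ncard_eq_toFinset_card']
    exact hmid1 a _ (hR a i)
  have hSpos : 0 < Fintype.card S := Fintype.card_pos
  have hBnot : ∀ {v}, v ∈ B → v ∈ C \ B → False := fun h h' => h'.2 h
  refine reroute hL f htr (fun i => ∃ a, col a = i) d (fun i => pr (d i))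
    (fun a i => (p a (R a i)).first) (fun a i => (p a (R a i)).last)
    (fun a i => (p a (R a i)).support) ?_ ?_ ?_ ?_ ?_ ?_ ?_ ?_ ?_ ?_ (X : Set V) (Y : Set V)
    ?_ ?_ ?_ ?_
  · intro a i _; exact first_mem _
  · intro a i _; exact last_mem _
  · intro a i _
    refine (reach_along (first_mem _) (last_mem _) (by rw [pos_first]; omega)).mono ?_
    intro x hx; exact hx.1
  · intro a i _
    have h1 := hfr (f a) _ (hR (f a) i)
    have h2 := hrl a _ (hR a i)
    exact back_edge hL hC (hf (f a) _ (hR (f a) i)) (hl a _ (hR a i))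
      (hBC (hfB _ _ (hR _ i))) (hlB _ _ (hR _ i)).1 (by omega)
  · intro a i b j _ _ hij
    by_cases hab : a = b
    · subst hab
      exact hdis a _ (hR a i) _ (hR a j) (fun h => hij (hRinj a i j h))
    · rw [Set.disjoint_left]
      intro v hv hv'
      have ha := hR a i
      have hb := hR b j
      rcases hsup a _ ha v hv with h | h | h <;> rcases hsup b _ hb v hv' with h' | h' | h'
      · apply hab; apply hcol
        exact col_unique hL.1 (hf a _ ha) (by rw [← h, h']; exact hf b _ hb)
      · exact hBnot (hfB a _ ha) (by rw [← h, h']; exact hlB b _ hb)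
      · exact hmid2 b _ hb v h' (hlink (col a) _ (by rw [h]; exact hf a _ ha))
      · exact hBnot (hfB b _ hb) (by rw [← h', h]; exact hlB a _ ha)
      · apply hab; apply hfi; apply hcol
        exact col_unique hL.1 (hl a _ ha) (by rw [← h, h']; exact hl b _ hb)
      · exact hmid2 b _ hb v h' (hlink (col (f a)) _ (by rw [h]; exact hl a _ ha))
      · exact hmid2 a _ ha v h (hlink (col b) _ (by rw [h']; exact hf b _ hb))
      · exact hmid2 a _ ha v h (hlink (col (f b)) _ (by rw [h']; exact hl b _ hb))
      · exact Set.disjoint_left.1 (g4 a b hab _ _) h h'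
  · intro a j _ i v hv hvi
    rcases hsup a _ (hR a j) v hv with h | h | h
    · exact ⟨a, col_unique hL.1 (hf a _ (hR a j)) (by rw [← h]; exact hvi)⟩
    · exact ⟨f a, col_unique hL.1 (hl a _ (hR a j)) (by rw [← h]; exact hvi)⟩
    · exact absurd (hlink i v hvi) (hmid2 a _ (hR a j) v h)
  · rintro _ ⟨a, rfl⟩
    simp only [hdc]; exact hf a _ (hR a _)
  · rintro _ ⟨a, rfl⟩
    simp only [hdc]
    have := hl (pr a) _ (hR (pr a) (col a))
    rwa [hpr] at this
  · rintro _ ⟨a0, rfl⟩ a j _ hj v hv hvi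
    simp only [hdc]
    rcases hsup a _ (hR a j) v hv with h | h | h
    · have e : a = a0 := hcol (col_unique hL.1 (hf a _ (hR a j)) (by rw [← h]; exact hvi))
      subst e
      rw [h]
      exact hfm a _ (hR a _) _ (hR a _) (hR0 a j hj)
    · have e : f a = a0 := hcol (col_unique hL.1 (hl a _ (hR a j)) (by rw [← h]; exact hvi))
      subst e
      rw [h]
      exact (hfr _ _ (hR _ _)).trans (hrl _ _ (hR _ _))
    · exact absurd (hlink _ v hvi) (hmid2 a _ (hR a j) v h)
  · rintro _ ⟨a0, rfl⟩ a j ⟨b, hb⟩ hj v hv hvi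
    simp only [hdc]
    have hpa := hrl (pr a0) _ (hR (pr a0) (col a0))
    rw [hpr] at hpa
    rcases hsup a _ (hR a j) v hv with h | h | h
    · have e : a = a0 := hcol (col_unique hL.1 (hf a _ (hR a j)) (by rw [← h]; exact hvi))
      subst e
      rw [h]
      exact (hfr _ _ (hR _ _)).trans hpa
    · have e : f a = a0 := hcol (col_unique hL.1 (hl a _ (hR a j)) (by rw [← h]; exact hvi))
      have e2 : pr a0 = a := hfi (by rw [hpr, e])
      rw [e2, h]
      have hne : f a ≠ a := by
        intro hh
        obtain ⟨T, hT⟩ := htr a b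
        rw [Function.iterate_fixed hh] at hT
        exact hj (by rw [← hb, ← hT, ← e, hh])
      have := hlm a _ (hR a j) _ (hR a (col (f a))) (hRl a j hne (by rw [e]; exact hj))
      rwa [e] at this
    · exact absurd (hlink _ v hvi) (hmid2 a _ (hR a j) v h)
  · intro v hv
    obtain ⟨a, _, ha⟩ := Finset.mem_biUnion.1 (Finset.mem_coe.1 hv)
    refine ⟨col a, ⟨a, rfl⟩, hXp a v ha, ?_⟩
    simp only [hdc]
    have hpa := hrl (pr a) _ (hR (pr a) (col a))
    rw [hpr] at hpa
    rcases hXm a v ha with h | ⟨u, h1, h2, _, h⟩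
    · rw [h]; exact ⟨hfr _ _ (hR _ _), hpa⟩
    · rw [h]; exact ⟨hfm a _ (hR _ _) _ h2 h1, (hfr _ _ h2).trans hpa⟩
  · intro v hv b j _ hvI
    obtain ⟨a, _, ha⟩ := Finset.mem_biUnion.1 (Finset.mem_coe.1 hv)
    have hvp := hXp a v ha
    rcases hXm a v ha with h | ⟨u, h1, h2, h3, h⟩
    · rcases hsup b _ (hR b j) v hvI with h' | h' | h'
      · exact hrB a (by rw [← h, h']; exact hfB b _ (hR b j))
      · have e : f b = a := hcol (col_unique hL.1 (hl b _ (hR b j)) (by rw [← h']; exact hvp))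
        have := hrl b _ (hR b j)
        rw [← h', e, h] at this
        omega
      · exact hmid2 b _ (hR b j) v h' (hlink _ v hvp)
    · rcases hsup b _ (hR b j) v hvI with h' | h' | h'
      · have e : b = a := hcol (col_unique hL.1 (hf b _ (hR b j)) (by rw [← h']; exact hvp))
        subst e
        exact h3 _ (hfinj b _ (hR b j) u h2 (by rw [← h', h]))
      · exact hBnot (hfB a u h2) (by rw [← h, h']; exact hlB b _ (hR b j))
      · exact hmid2 b _ (hR b j) v h' (hlink _ v hvp)
  · intro a i _ v hv
    rcases hsup a _ (hR a i) v hv with h | h | h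
    · exact Or.inl (hlink _ _ (by rw [h]; exact hf a _ (hR a i)))
    · exact Or.inl (hlink _ _ (by rw [h]; exact hl a _ (hR a i)))
    · refine Or.inr (Finset.mem_coe.2 ?_)
      refine Finset.mem_biUnion.2 ⟨a, Finset.mem_univ _, Finset.mem_biUnion.2
        ⟨i, Finset.mem_univ _, ?_⟩⟩
      simpa using h
  · rw [Set.ncard_coe_finset, Set.ncard_coe_finset]
    have : Fintype.card S * k < (k + 1) * Fintype.card S := by nlinarith
    omega

theorem mem_take_iff (P : Dpath G) (n : ℕ) (x : V) :
    x ∈ P.verts.take n ↔ x ∈ P.verts ∧ pos P x < n := by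
  constructor
  · intro h
    obtain ⟨m, hm, he⟩ := List.mem_take_iff_getElem.1 h
    have h1 : m < P.verts.length := by omega
    refine ⟨he ▸ List.getElem_mem _, ?_⟩
    rw [← he, pos_getElem]; omega
  · rintro ⟨h1, h2⟩
    have := pos_lt h1
    exact List.mem_take_iff_getElem.2 ⟨pos P x, by omega, getElem_pos h1⟩

theorem mid_card (P : Dpath G) (h : P.verts.length ≤ 3) (hne : P.first ≠ P.last) :
    (P.support \ {P.first, P.last}).ncard ≤ 1 := by
  have h1 : P.support.ncard ≤ 3 := by
    have : P.support = (P.verts.toFinset : Set V) := by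
      ext x; simp [Dpath.support]
    rw [this, Set.ncard_coe_finset]
    exact (List.toFinset_card_le _).trans h
  have hfin : P.support.Finite := P.verts.finite_toSet
  have hsub : ({P.first, P.last} : Set V) ⊆ P.support := by
    rintro x (rfl | rfl)
    · exact first_mem _
    · exact last_mem _
  have h2 := Set.ncard_sdiff_add_ncard_of_subset hsub hfin
  rw [Set.ncard_pair hne] at h2
  omega

theorem insert_cacc {k : ℕ} {sv tv : Fin k → V} {L : Fin k → Dpath G}
    (hL : IsLinkage L) {C B : Set V}
    (hacc : CAcceptable sv tv L C B) {j : Fin k} {r : V} (hr : r ∈ (L j).verts)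
    (hrC : r ∈ C) (hrB : r ∉ B) (hrt : r ∉ Set.range tv)
    (hrmin : ∀ x ∈ (L j).verts, x ∈ C → x ∉ B → pos (L j) r ≤ pos (L j) x)
    (hno : ¬ CAcceptable sv tv L C (insert r B)) :
    ∃ j', ∃ M : Fin (k ^ 2 + k + 2) → Dpath G,
      IsPlanarMatchingFromTo (L j) (L j') M (insert r B) (C \ insert r B) ∧
        InternallyDisjointFrom M L := by
  have hacc' := hacc
  obtain ⟨h1, h2, h3, h4, h5⟩ := hacc
  by_contra hcon
  apply hno
  refine ⟨Set.insert_subset hrC h1, h2.trans (Set.subset_insert _ _), ?_, ?_, ?_⟩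
  · rw [Set.eq_empty_iff_forall_notMem] at h3 ⊢
    rintro x ⟨hx, hx'⟩
    rcases hx' with rfl | hx'
    · exact hrt hx
    · exact h3 x ⟨hx, hx'⟩
  · intro i
    by_cases hij : i = j
    · subst hij
      refine ⟨⟨(L i).verts.take (pos (L i) r + 1), ?_, ?_, ?_⟩, List.take_prefix _ _, ?_⟩
      · intro he
        have : r ∈ (L i).verts.take (pos (L i) r + 1) := (mem_take_iff _ _ _).2 ⟨hr, by omega⟩
        rw [he] at this; simp at this
      · exact (L i).nodup.sublist (List.take_sublist _ _)
      · exact List.IsChain.take (L i).chain _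
      · ext x
        show x ∈ (L i).verts.take (pos (L i) r + 1) ∧ x ∈ C ↔ x ∈ (L i).verts ∧ x ∈ insert r B
        rw [mem_take_iff]
        constructor
        · rintro ⟨⟨hx, hp⟩, hxC⟩
          refine ⟨hx, ?_⟩
          by_cases hxB : x ∈ B
          · exact Or.inr hxB
          · have := hrmin x hx hxC hxB
            exact Or.inl (pos_inj hx hr (by omega))
        · rintro ⟨hx, hx'⟩
          rcases hx' with rfl | hxB
          · exact ⟨⟨hx, by omega⟩, hrC⟩
          · refine ⟨⟨hx, ?_⟩, h1 hxB⟩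
            by_contra hlt
            exact hrB (init_of_cacc hacc' hr hx hrC hxB (by omega))
    · obtain ⟨Q, hQ1, hQ2⟩ := h4 i
      refine ⟨Q, hQ1, ?_⟩
      rw [hQ2]
      ext x
      constructor
      · rintro ⟨a, b⟩; exact ⟨a, Or.inr b⟩
      · rintro ⟨a, b⟩
        rcases b with rfl | b
        · exact absurd (col_unique hL a hr) hij
        · exact ⟨a, b⟩
  · rintro i j' ⟨M, ⟨hM1, hM2⟩, hM3⟩
    by_cases hij : i = j
    · subst hij
      exact hcon ⟨j', M, ⟨hM1, hM2⟩, hM3⟩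
    · apply h5 i j'
      refine ⟨M, ⟨hM1, ?_⟩, hM3⟩
      intro x
      obtain ⟨ha, hb⟩ := hM2 x
      refine ⟨?_, hb.1, fun h => hb.2 (Or.inr h)⟩
      rcases ha with h | h
      · exfalso
        have hm := ((ofFn_sublist_iff _ _).1 hM1.2.2.1).1 x
        rw [h] at hm
        exact hij (col_unique hL hm hr)
      · exact h

theorem step1fail {k : ℕ} {sv tv : Fin k → V} {L : Fin k → Dpath G}
    {C B : Set V} (hacc : CAcceptable sv tv L C B) {j j' : Fin k} {r : V}
    (hr : r ∈ (L j).verts) (hrC : r ∈ C) (hrB : r ∉ B)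
    (M : Fin (k ^ 2 + k + 2) → Dpath G)
    (hM : IsPlanarMatchingFromTo (L j) (L j') M (insert r B) (C \ insert r B))
    (hMd : InternallyDisjointFrom M L) (n : ℕ) (hn : n = k ^ 2 + k) :
    ∃ (p : ℕ → Dpath G) (mid : ℕ → Set V) (w : V),
      (∀ u < n, ∀ v < n, u ≠ v → Disjoint (p u).support (p v).support) ∧
      (∀ u < n, (mid u).ncard ≤ 1) ∧
      (∀ u < n, ∀ v ∈ mid u, v ∉ linkSupport L) ∧
      (∀ u < n, mid u ⊆ (p u).support) ∧
      (∀ u < n, ∀ v ∈ (p u).support, v = (p u).first ∨ v = (p u).last ∨ v ∈ mid u) ∧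
      (∀ u < n, (p u).first ∈ (L j).verts) ∧
      (∀ u < n, (p u).first ∈ B) ∧
      (∀ u < n, ∀ v < n, u < v → pos (L j) (p u).first < pos (L j) (p v).first) ∧
      (∀ u < n, (p u).last ∈ (L j').verts) ∧
      (∀ u < n, (p u).last ∈ C \ B) ∧
      (∀ u < n, ∀ v < n, u < v → pos (L j') (p u).last < pos (L j') (p v).last) ∧
      w ∈ (L j').verts ∧ w ∈ C \ B ∧ ∀ u < n, pos (L j') w < pos (L j') (p u).last := by
  obtain ⟨⟨m1, m2, m3, m4⟩, m5⟩ := hM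
  rw [ofFn_sublist_iff] at m3 m4
  obtain ⟨a1, a2⟩ := m3
  obtain ⟨b1, b2⟩ := m4
  have hlB : ∀ x, (M x).last ∈ C \ B := fun x => ⟨(m5 x).2.1, fun h => (m5 x).2.2 (Or.inr h)⟩
  have hfB : ∀ x : Fin (k ^ 2 + k + 2), (x : ℕ) < n + 1 → (M x).first ∈ B := by
    intro x hx
    rcases (m5 x).1 with h | h
    · exfalso
      let y : Fin (k ^ 2 + k + 2) := ⟨n + 1, by omega⟩
      have hxy := a2 x y hx
      rw [h] at hxy
      rcases (m5 y).1 with h' | h'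
      · rw [h'] at hxy; omega
      · exact hrB (init_of_cacc hacc hr (a1 y) hrC h' hxy.le)
    · exact h
  let ix : ℕ → Fin (k ^ 2 + k + 2) := fun u => if h : u + 1 < k ^ 2 + k + 2 then ⟨u + 1, h⟩ else
    ⟨0, by omega⟩
  have hix : ∀ u < n, (ix u : ℕ) = u + 1 := by
    intro u hu
    have : u + 1 < k ^ 2 + k + 2 := by omega
    simp only [ix, dif_pos this]
  have hixl : ∀ u < n, ∀ v < n, u < v → ix u < ix v := by
    intro u hu v hv h
    show (ix u : ℕ) < (ix v : ℕ)
    rw [hix u hu, hix v hv]; omega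
  have hixn : ∀ u < n, ∀ v < n, u ≠ v → ix u ≠ ix v := by
    intro u hu v hv h he
    have := congrArg Fin.val he
    rw [hix u hu, hix v hv] at this; omega
  have hfBu : ∀ u < n, (M (ix u)).first ∈ B := fun u hu => hfB _ (by rw [hix u hu]; omega)
  let o : Fin (k ^ 2 + k + 2) := ⟨0, by omega⟩
  refine ⟨fun u => M (ix u), fun u => (M (ix u)).support \ {(M (ix u)).first, (M (ix u)).last},
    (M o).last, ?_, ?_, ?_, ?_, ?_, ?_, ?_, ?_, ?_, ?_, ?_, ?_, ?_, ?_⟩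
  · intro u hu v hv huv
    exact m1 _ _ (hixn u hu v hv huv)
  · intro u hu
    refine mid_card _ (m2 _) ?_
    intro h
    exact (hlB (ix u)).2 (h ▸ hfBu u hu)
  · rintro u hu v ⟨hv1, hv2⟩
    apply hMd
    refine ⟨Set.mem_iUnion.2 ⟨_, hv1⟩, ?_⟩
    rintro (⟨y, hy⟩ | ⟨y, hy⟩)
    · have hy' : (M y).first = v := hy
      by_cases he : ix u = y
      · subst he; exact hv2 (Or.inl hy'.symm)
      · exact Set.disjoint_left.1 (m1 _ _ he) hv1 (by rw [← hy']; exact first_mem _)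
    · have hy' : (M y).last = v := hy
      by_cases he : ix u = y
      · subst he; exact hv2 (Or.inr hy'.symm)
      · exact Set.disjoint_left.1 (m1 _ _ he) hv1 (by rw [← hy']; exact last_mem _)
  · intro u hu; exact Set.sdiff_subset
  · intro u hu v hv
    by_cases h1 : v = (M (ix u)).first
    · exact Or.inl h1
    · by_cases h2 : v = (M (ix u)).last
      · exact Or.inr (Or.inl h2)
      · refine Or.inr (Or.inr ⟨hv, ?_⟩)
        rintro (h | h)
        · exact h1 h
        · exact h2 h
  · intro u hu; exact a1 _
  · exact hfBu
  · intro u hu v hv h; exact a2 _ _ (hixl u hu v hv h)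
  · intro u hu; exact b1 _
  · intro u hu; exact hlB _
  · intro u hu v hv h; exact b2 _ _ (hixl u hu v hv h)
  · exact b1 _
  · exact hlB _
  · intro u hu
    apply b2
    show 0 < (ix u : ℕ)
    rw [hix u hu]; omega

theorem step1 [Fintype V] {k : ℕ} {sv tv : Fin k → V} {L : Fin k → Dpath G}
    (hLf : IsMinimumLinkageFor L sv tv) {C B : Set V} (hC : G.IsClique C)
    (hacc : CAcceptable sv tv L C B)
    (hex : ∃ v ∈ C, v ∈ linkSupport L ∧ v ∉ B ∧ v ∉ Set.range tv) :
    ∃ v ∈ C, v ∈ linkSupport L ∧ v ∉ B ∧ v ∉ Set.range tv ∧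
      CAcceptable sv tv L C (insert v B) := by
  by_contra hcon
  have hL := hLf.2
  have hlast : ∀ i, (L i).last = tv i := fun i => (hLf.1.2 i).2
  let U : Set (Fin k) := {j | ∃ x ∈ (L j).verts, x ∈ C ∧ x ∉ B ∧ x ≠ tv j}
  have hUne : U.Nonempty := by
    obtain ⟨v, h1, h2, h3, h4⟩ := hex
    obtain ⟨j, hj⟩ := Set.mem_iUnion.1 h2
    exact ⟨j, v, hj, h1, h3, fun h => h4 ⟨j, h.symm⟩⟩
  have hr : ∀ j : U, ∃ r ∈ (L j).verts, r ∈ C ∧ r ∉ B ∧ r ∉ Set.range tv ∧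
      ∀ x ∈ (L j).verts, x ∈ C → x ∉ B → pos (L j) r ≤ pos (L j) x := by
    rintro ⟨j, x, hx1, hx2, hx3, hx4⟩
    obtain ⟨r, ⟨r1, r2, r3⟩, hmin⟩ := Set.exists_min_image
      {r | r ∈ (L j).verts ∧ r ∈ C ∧ r ∉ B} (pos (L j)) (Set.toFinite _) ⟨x, hx1, hx2, hx3⟩
    refine ⟨r, r1, r2, r3, ?_, fun y h1 h2 h3 => hmin y ⟨h1, h2, h3⟩⟩
    rintro ⟨i, hi⟩
    have hij : i = j := col_unique hL.1 (by rw [← hi, ← hlast i]; exact last_mem _) r1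
    subst hij
    have e1 := hmin x ⟨hx1, hx2, hx3⟩
    have e2 := pos_le_last hx1
    rw [hlast i, hi] at e2
    exact hx4 (by rw [hi]; exact pos_inj hx1 r1 (by omega))
  choose r r1 r2 r3 r4 r5 using hr
  have hmain : ∀ j : U, ∃ (j' : U) (p : ℕ → Dpath G) (mid : ℕ → Set V),
      (∀ u < k ^ 2 + k, ∀ v < k ^ 2 + k, u ≠ v → Disjoint (p u).support (p v).support) ∧
      (∀ u < k ^ 2 + k, (mid u).ncard ≤ 1) ∧
      (∀ u < k ^ 2 + k, ∀ v ∈ mid u, v ∉ linkSupport L) ∧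
      (∀ u < k ^ 2 + k, mid u ⊆ (p u).support) ∧
      (∀ u < k ^ 2 + k, ∀ v ∈ (p u).support, v = (p u).first ∨ v = (p u).last ∨ v ∈ mid u) ∧
      (∀ u < k ^ 2 + k, (p u).first ∈ (L j).verts) ∧
      (∀ u < k ^ 2 + k, (p u).first ∈ B) ∧
      (∀ u < k ^ 2 + k, ∀ v < k ^ 2 + k, u < v →
        pos (L j) (p u).first < pos (L j) (p v).first) ∧
      (∀ u < k ^ 2 + k, (p u).last ∈ (L j').verts) ∧
      (∀ u < k ^ 2 + k, (p u).last ∈ C \ B) ∧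
      (∀ u < k ^ 2 + k, ∀ v < k ^ 2 + k, u < v →
        pos (L j') (p u).last < pos (L j') (p v).last) ∧
      (∀ u < k ^ 2 + k, pos (L j) (p u).first < pos (L j) (r j)) ∧
      (∀ u < k ^ 2 + k, pos (L j') (r j') < pos (L j') (p u).last) := by
    intro j
    obtain ⟨j', M, hM, hMd⟩ := insert_cacc hL.1 hacc (r1 j) (r2 j) (r3 j) (r4 j) (r5 j)
      (fun h => hcon ⟨r j, r2 j, Set.mem_iUnion.2 ⟨_, r1 j⟩, r3 j, r4 j, h⟩)
    obtain ⟨p, mid, w, c1, c2, c3, c4, c5, c6, c7, c8, c9, c10, c11, w1, w2, w3⟩ :=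
      step1fail hacc (r1 j) (r2 j) (r3 j) M hM hMd _ rfl
    have hn : 0 < k ^ 2 + k := by have := j.1.pos; positivity
    have hj' : j' ∈ U := by
      refine ⟨w, w1, w2.1, w2.2, ?_⟩
      intro he
      have e1 := w3 0 hn
      have e2 := pos_le_last (c9 0 hn)
      rw [hlast j', ← he] at e2
      omega
    refine ⟨⟨j', hj'⟩, p, mid, c1, c2, c3, c4, c5, c6, c7, c8, c9, c10, c11, ?_, ?_⟩
    · intro u hu
      by_contra hlt
      exact r3 j (init_of_cacc hacc (r1 j) (c6 u hu) (r2 j) (c7 u hu) (by omega))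
    · intro u hu
      exact (r5 ⟨j', hj'⟩ w w1 w2.1 w2.2).trans_lt (w3 u hu)
  choose F p mid c1 c2 c3 c4 c5 c6 c7 c8 c9 c10 c11 c12 c13 using hmain
  have hUn : Nonempty U := hUne.to_subtype
  obtain ⟨S, _, hS1, hS2, hS3⟩ := exists_cycle F Set.univ Set.univ_nonempty (fun _ _ => trivial)
  let F' : S → S := fun a => ⟨F a, hS2 a a.2⟩
  have hSn : Nonempty S := hS1.to_subtype
  refine step1core hL hC hacc.1 F' ?_ (fun a : S => a.1.1) ?_ (fun a => p a.1)
    (fun a => mid a.1) (k ^ 2 + k) rfl (fun a => r a.1) (fun a => c1 a.1) (fun a => c2 a.1)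
    (fun a => c3 a.1) (fun a => c4 a.1) (fun a => c5 a.1) (fun a => c6 a.1) (fun a => c7 a.1)
    (fun a => c8 a.1) (fun a => c9 a.1) (fun a => c10 a.1) (fun a => c11 a.1)
    (fun a => r1 a.1) (fun a => r3 a.1) (fun a => c12 a.1) (fun a => c13 a.1)
  · intro a b
    obtain ⟨T, hT⟩ := hS3 a a.2 b b.2
    refine ⟨T, Subtype.ext ?_⟩
    rw [iterate_sub F S F' (fun _ => rfl), hT]
  · intro a b h
    exact Subtype.ext (Subtype.ext h)

theorem good_rows {k : ℕ} {sv tv : Fin k → V} {L : Fin k → Dpath G} {C B : Set V}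
    (hC : G.IsClique C) (hacc : CAcceptable sv tv L C B) {i j : Fin k}
    (D : ℕ) (hD : D = k ^ 2 + k + 1 + k) (x y : ℕ → V)
    (hx : ∀ u < D, x u ∈ (L i).verts) (hxB : ∀ u < D, x u ∈ B)
    (hxm : ∀ u v, u < v → v < D → pos (L i) (x u) < pos (L i) (x v))
    (hy : ∀ u < D, y u ∈ (L j).verts) (hyB : ∀ u < D, y u ∈ C \ B)
    (hym : ∀ u v, u < v → v < D → pos (L j) (y u) < pos (L j) (y v)) :
    ∃ g : Fin k → ℕ, StrictMono g ∧ (∀ x, g x < D) ∧ ∀ a, G.adj (y (g a)) (x (g a)) := by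
  let Bad : Finset ℕ := (Finset.range D).filter fun u => ¬ G.adj (y u) (x u)
  have hBad : Bad.card ≤ k ^ 2 + k + 1 := by
    by_contra hlt
    have hc : k ^ 2 + k + 2 ≤ Bad.card := by omega
    let w : Fin (k ^ 2 + k + 2) → ℕ := fun h => Bad.orderEmbOfFin rfl (Fin.castLE hc h)
    have hw : ∀ h, w h ∈ Bad := fun h => Finset.orderEmbOfFin_mem _ _ _
    have hwD : ∀ h, w h < D := fun h => Finset.mem_range.1 (Finset.mem_filter.1 (hw h)).1
    have hwm : ∀ h h', h < h' → w h < w h' := by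
      intro h h' hh
      exact (Bad.orderEmbOfFin rfl).strictMono (by simpa using hh)
    have hne : ∀ u < D, ∀ v < D, x u ≠ y v := by
      intro u hu v hv he
      exact (hyB v hv).2 (he ▸ hxB u hu)
    have hadj : ∀ h, G.adj (x (w h)) (y (w h)) := by
      intro h
      have h1 := (Finset.mem_filter.1 (hw h)).2
      rcases hC _ (hacc.1 (hxB _ (hwD h))) _ (hyB _ (hwD h)).1 (hne _ (hwD h) _ (hwD h)) with h2 | h2
      · exact h2
      · exact absurd h2 h1
    let M : Fin (k ^ 2 + k + 2) → Dpath G := fun h =>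
      ⟨[x (w h), y (w h)], by simp, by simp [hne _ (hwD h) _ (hwD h)], by
        show List.IsChain _ _
        simp [hadj h]⟩
    have hMf : ∀ h, (M h).first = x (w h) := fun h => rfl
    have hMl : ∀ h, (M h).last = y (w h) := fun h => rfl
    have hxinj : ∀ h h', h ≠ h' → x (w h) ≠ x (w h') := by
      intro h h' hh he
      rcases lt_or_gt_of_ne hh with h1 | h1
      · have := hxm _ _ (hwm _ _ h1) (hwD _); rw [he] at this; omega
      · have := hxm _ _ (hwm _ _ h1) (hwD _); rw [he] at this; omega
    have hyinj : ∀ h h', h ≠ h' → y (w h) ≠ y (w h') := by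
      intro h h' hh he
      rcases lt_or_gt_of_ne hh with h1 | h1
      · have := hym _ _ (hwm _ _ h1) (hwD _); rw [he] at this; omega
      · have := hym _ _ (hwm _ _ h1) (hwD _); rw [he] at this; omega
    have hsup : ∀ h v, v ∈ (M h).support → v = x (w h) ∨ v = y (w h) := by
      intro h v hv
      simpa [M, Dpath.support] using hv
    apply hacc.2.2.2.2 i j
    refine ⟨M, ⟨⟨?_, ?_, ?_, ?_⟩, ?_⟩, ?_⟩
    · intro h h' hh
      rw [Set.disjoint_left]
      intro v hv hv'
      rcases hsup h v hv with e | e <;> rcases hsup h' v hv' with e' | e'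
      · exact hxinj h h' hh (e.symm.trans e')
      · exact hne _ (hwD h) _ (hwD h') (e.symm.trans e')
      · exact hne _ (hwD h') _ (hwD h) (e'.symm.trans e)
      · exact hyinj h h' hh (e.symm.trans e')
    · intro h; simp [M]
    · rw [ofFn_sublist_iff]
      exact ⟨fun h => hx _ (hwD h), fun h h' hh => hxm _ _ (hwm _ _ hh) (hwD _)⟩
    · rw [ofFn_sublist_iff]
      exact ⟨fun h => hy _ (hwD h), fun h h' hh => hym _ _ (hwm _ _ hh) (hwD _)⟩
    · intro h; exact ⟨hxB _ (hwD h), hyB _ (hwD h)⟩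
    · rintro v ⟨hv1, hv2⟩
      exfalso
      obtain ⟨h, hh⟩ := Set.mem_iUnion.1 hv1
      apply hv2
      rcases hsup h v hh with e | e
      · exact Or.inl ⟨h, e.symm⟩
      · exact Or.inr ⟨h, e.symm⟩
  obtain ⟨g, g1, g2, g3, _⟩ := pick Bad D k (by omega)
  refine ⟨g, g1, g2, fun a => ?_⟩
  by_contra hn
  exact g3 a (Finset.mem_filter.2 ⟨Finset.mem_range.2 (g2 a), hn⟩)

theorem step3b [Fintype V] {k : ℕ} {sv tv : Fin k → V} {L : Fin k → Dpath G}
    (hL : IsMinimumLinkage L) {B : Set V}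
    {S : Type} [Finite S] [Nonempty S] (f : S → S) (htr : ∀ a b, ∃ T, f^[T] a = b)
    (K : S → Set V) (hK : ∀ a, G.IsClique (K a))
    (hacc : ∀ a, CAcceptable sv tv L (K a) (B ∩ K a))
    (col : S → Fin k) (x y : S → ℕ → V) (D N : ℕ) (hD : D = k ^ 2 + k + 1 + k)
    (hN : N = 2 * D + 1)
    (hx : ∀ a, ∀ u < N, x a u ∈ (L (col a)).verts) (hxB : ∀ a, ∀ u < N, x a u ∈ B ∩ K a)
    (hy : ∀ a, ∀ u < N, y a u ∈ (L (col a)).verts) (hyB : ∀ a, ∀ u < N, y a u ∉ B)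
    (hyK : ∀ a, ∀ u < N, y a u ∈ K (f a))
    (px py : S → ℕ → ℕ) (hpx : ∀ a u, px a u = pos (L (col a)) (x a u))
    (hpy : ∀ a u, py a u = pos (L (col a)) (y a u))
    (hxy : ∀ a, ∀ u < N, px a u < py a u)
    (hyx : ∀ a, ∀ u v, u < v → v < N → py a u < px a v)
    (hblk : ∀ a b, a ≠ b → col a = col b → py a (N - 1) < px b 0 ∨ py b (N - 1) < px a 0) :
    False := by
  have hDN : D < N := by omega
  have hN1 : N - 1 < N := by omega
  have hxx : ∀ a u v, u ≤ v → v < N → px a u ≤ px a v := by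
    intro a u v huv hv
    rcases Nat.eq_or_lt_of_le huv with rfl | h
    · exact le_rfl
    · exact ((hxy a u (by omega)).trans (hyx a u v h hv)).le
  have hxs : ∀ a u v, u < v → v < N → px a u < px a v := by
    intro a u v h hv
    exact (hxy a u (by omega)).trans (hyx a u v h hv)
  have hyy : ∀ a u v, u ≤ v → v < N → py a u ≤ py a v := by
    intro a u v huv hv
    rcases Nat.eq_or_lt_of_le huv with rfl | h
    · exact le_rfl
    · exact ((hyx a u v h hv).trans (hxy a v hv)).le
  obtain ⟨hfi, hfs⟩ := trans_bij f htr
  have hin : ∀ a, col a = col (f a) → ∀ u < N, ∀ v < N, px (f a) u < py a v := by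
    intro a hc u hu v hv
    by_contra hlt
    have h1 := hy a v hv
    rw [hc] at h1
    refine hyB a v hv (init_of_cacc (hacc (f a)) h1 (hx (f a) u hu) (hyK a v hv)
      (hxB (f a) u hu) ?_).1
    rw [hpx, hpy, hc] at hlt
    omega
  -- good rows
  have hg : ∀ a, ∃ g : Fin k → ℕ, StrictMono g ∧ (∀ z, g z < D) ∧
      ∀ z, G.adj (y a (g z)) (x (f a) (g z + D + 1)) := by
    intro a
    refine good_rows (hK (f a)) (hacc (f a)) (i := col (f a)) (j := col a) D hD
      (fun u => x (f a) (u + D + 1)) (fun u => y a u) ?_ ?_ ?_ ?_ ?_ ?_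
    · intro u hu; exact hx _ _ (by omega)
    · intro u hu; exact hxB _ _ (by omega)
    · intro u v huv hv
      have := hxs (f a) (u + D + 1) (v + D + 1) (by omega) (by omega)
      rwa [hpx, hpx] at this
    · intro u hu; exact hy _ _ (by omega)
    · intro u hu; exact ⟨hyK _ _ (by omega), fun h => hyB _ _ (by omega) h.1⟩
    · intro u v huv hv
      have h1 := hyx a u v huv (by omega)
      have h2 := hxy a v (by omega)
      rw [hpx] at h1 h2
      rw [hpy] at h1 h2
      omega
  choose g g1 g2 g3 using hg
  have hdex : ∀ i : Fin k, ∃ d : S, (∃ a, col a = i) → col d = i ∧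
      ∀ b, col b = i → px d 0 ≤ px b 0 := by
    intro i
    by_cases h : ∃ a, col a = i
    · obtain ⟨d, hd1, hd2⟩ := Set.exists_min_image {a | col a = i} (fun a => px a 0)
        (Set.toFinite _) h
      exact ⟨d, fun _ => ⟨hd1, hd2⟩⟩
    · exact ⟨Classical.arbitrary S, fun h' => absurd h' h⟩
  have hlex : ∀ i : Fin k, ∃ d : S, (∃ a, col a = i) → col d = i ∧
      ∀ b, col b = i → px b 0 ≤ px d 0 := by
    intro i
    by_cases h : ∃ a, col a = i
    · obtain ⟨d, hd1, hd2⟩ := Set.exists_max_image {a | col a = i} (fun a => px a 0)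
        (Set.toFinite _) h
      exact ⟨d, fun _ => ⟨hd1, hd2⟩⟩
    · exact ⟨Classical.arbitrary S, fun h' => absurd h' h⟩
  choose d hd using hdex
  choose la hla using hlex
  choose pr hpr using hfs
  have hdblk : ∀ a, a ≠ d (col a) → py (d (col a)) (N - 1) < px a 0 := by
    intro a ha
    obtain ⟨e1, e2⟩ := hd (col a) ⟨a, rfl⟩
    rcases hblk a _ ha e1.symm with h | h
    · have h1 := e2 a rfl
      have h2 := hxx a 0 (N - 1) (by omega) hN1
      have h3 := hxy a (N - 1) hN1
      omega
    · exact h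
  have hlblk : ∀ a, a ≠ la (col a) → py a (N - 1) < px (la (col a)) 0 := by
    intro a ha
    obtain ⟨e1, e2⟩ := hla (col a) ⟨a, rfl⟩
    rcases hblk a _ ha e1.symm with h | h
    · exact h
    · have h1 := e2 a rfl
      have h2 := hxx (la (col a)) 0 (N - 1) (by omega) hN1
      have h3 := hxy (la (col a)) (N - 1) hN1
      omega
  have hσ : ∀ a, ∃ σ : Fin k ≃ Fin k, (a = d (col a) → (σ (col a) : ℕ) = 0) ∧
      (f a = la (col (f a)) → (σ (col (f a)) : ℕ) = k - 1) := by
    intro a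
    apply exists_perm
    intro h1 h2 hc
    have e := hin a hc
    by_cases hfa : f a = a
    · have e1 := e 1 (by omega) 0 (by omega)
      have e2 := hyx a 0 1 (by omega) (by omega)
      rw [hfa] at e1
      omega
    · have h3 : f a ≠ d (col (f a)) := by rw [← hc, ← h1]; exact hfa
      have h4 := hdblk (f a) h3
      rw [← hc, ← h1] at h4
      have h5 := e 0 (by omega) (N - 1) hN1
      omega
  choose σ hσ0 hσl using hσ
  let R : S → Fin k → ℕ := fun a i => g a (σ a i)
  have hR : ∀ a i, R a i < D := fun a i => g2 a _
  have hRinj : ∀ a i j, R a i = R a j → i = j := fun a i j h => (σ a).injective ((g1 a).injective h)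
  have hR0 : ∀ a i, a = d (col a) → i ≠ col a → R a (col a) < R a i := by
    intro a i ha hi
    apply g1 a
    show (σ a (col a) : ℕ) < (σ a i : ℕ)
    rw [hσ0 a ha]
    by_contra hh
    apply hi
    apply (σ a).injective
    ext
    rw [hσ0 a ha]; omega
  have hRl : ∀ a i, f a = la (col (f a)) → i ≠ col (f a) → R a i < R a (col (f a)) := by
    intro a i ha hi
    apply g1 a
    show (σ a i : ℕ) < (σ a (col (f a)) : ℕ)
    rw [hσl a ha]
    by_contra hh
    apply hi
    apply (σ a).injective
    ext
    rw [hσl a ha]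
    have := (σ a i).isLt
    omega
  let cell : S → ℕ → Set V := fun a u =>
    {v | v ∈ (L (col a)).verts ∧ px a u ≤ pos (L (col a)) v ∧ pos (L (col a)) v ≤ py a u}
  have hxcell : ∀ a, ∀ u < N, x a u ∈ cell a u := by
    intro a u hu
    refine ⟨hx a u hu, by rw [hpx], ?_⟩
    rw [← hpx]; exact (hxy a u hu).le
  have hycell : ∀ a, ∀ u < N, y a u ∈ cell a u := by
    intro a u hu
    refine ⟨hy a u hu, ?_, by rw [hpy]⟩
    rw [← hpy]; exact (hxy a u hu).le
  have hcell : ∀ a b v u u', u < N → u' < N → v ∈ cell a u → v ∈ cell b u' → a = b ∧ u = u' := by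
    rintro a b v u u' hu hu' ⟨h1, h2, h3⟩ ⟨k1, k2, k3⟩
    have hc := col_unique hL.1 h1 k1
    by_cases hab : a = b
    · subst hab
      refine ⟨rfl, ?_⟩
      by_contra hne
      rcases Nat.lt_or_gt_of_ne hne with h | h
      · have := hyx a u u' h hu'; omega
      · have := hyx a u' u h hu; omega
    · exfalso
      rw [← hc] at k2 k3
      have i1 := hxx a 0 u (by omega) hu
      have i2 := hxx b 0 u' (by omega) hu'
      have i3 := hyy a u (N - 1) (by omega) hN1
      have i4 := hyy b u' (N - 1) (by omega) hN1
      rcases hblk a b hab hc with h | h <;> omega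
  let I : S → Fin k → Set V := fun a i => insert (x (f a) (R a i + D + 1)) (cell a (R a i))
  have hI : ∀ a i v, v ∈ I a i → v ∈ cell a (R a i) ∨ v ∈ cell (f a) (R a i + D + 1) := by
    intro a i v hv
    rcases hv with rfl | hv
    · exact Or.inr (hxcell _ _ (by have := hR a i; omega))
    · exact Or.inl hv
  let i0 : Fin k := col (Classical.arbitrary S)
  refine reroute hL f htr (fun i => ∃ a, col a = i) d (fun i => pr (la i))
    (fun a i => x a (R a i)) (fun a i => x (f a) (R a i + D + 1)) I
    ?_ ?_ ?_ ?_ ?_ ?_ ?_ ?_ ?_ ?_ {x (d i0) D} ∅ ?_ ?_ ?_ ?_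
  · intro a i _
    exact Or.inr (hxcell a _ (by have := hR a i; omega))
  · intro a i _; exact Or.inl rfl
  · intro a i _
    have hr := hR a i
    refine Reach.trans' (v := y a (R a i)) ?_ (Reach.edge (g3 a _) ?_ (Or.inl rfl))
    · refine (reach_along (hx a _ (by omega)) (hy a _ (by omega)) ?_).mono ?_
      · rw [← hpx, ← hpy]; exact (hxy a _ (by omega)).le
      · rintro v ⟨h1, h2, h3⟩
        refine Or.inr ⟨h1, ?_, ?_⟩
        · rw [hpx]; exact h2
        · rw [hpy]; exact h3
    · exact Or.inr (hycell a _ (by omega))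
  · intro a i _
    have hr := hR a i
    have hr' := hR (f a) i
    refine back_edge hL (hK (f a)) (hx (f a) _ (by omega)) (hx (f a) _ (by omega))
      (hxB (f a) _ (by omega)).2 (hxB (f a) _ (by omega)).2 ?_
    rw [← hpx, ← hpx]
    have h1 := hxy (f a) (R (f a) i) (by omega)
    have h2 := hyx (f a) (R (f a) i) (R a i + D + 1) (by omega) (by omega)
    omega
  · intro a i b j _ _ hij
    rw [Set.disjoint_left]
    intro v hv hv'
    have hr := hR a i
    have hr' := hR b j
    rcases hI a i v hv with h | h <;> rcases hI b j v hv' with h' | h'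
    · obtain ⟨e1, e2⟩ := hcell _ _ _ _ _ (by omega) (by omega) h h'
      subst e1; exact hij (hRinj a i j e2)
    · obtain ⟨e1, e2⟩ := hcell _ _ _ _ _ (by omega) (by omega) h h'
      omega
    · obtain ⟨e1, e2⟩ := hcell _ _ _ _ _ (by omega) (by omega) h h'
      omega
    · obtain ⟨e1, e2⟩ := hcell _ _ _ _ _ (by omega) (by omega) h h'
      have e3 := hfi e1
      subst e3; exact hij (hRinj a i j (by omega))
  · intro a j _ i v hv hvi
    rcases hI a j v hv with h | h
    · exact ⟨a, col_unique hL.1 h.1 hvi⟩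
    · exact ⟨f a, col_unique hL.1 h.1 hvi⟩
  · intro i hi
    have := hx (d i) (R (d i) i) (by have := hR (d i) i; omega)
    rwa [(hd i hi).1] at this
  · intro i hi
    have := hx (la i) (R (pr (la i)) i + D + 1) (by have := hR (pr (la i)) i; omega)
    rw [(hla i hi).1] at this
    show x (f (pr (la i))) _ ∈ _
    rwa [hpr]
  · intro i hi a j _ hj v hv hvi
    obtain ⟨e1, e2⟩ := hd i hi
    have key : pos (L i) (x (d i) (R (d i) i)) = px (d i) (R (d i) i) := by rw [hpx, e1]
    show pos (L i) (x (d i) (R (d i) i)) < _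
    rw [key]
    have hrd := hR (d i) i
    have hra := hR a j
    have hbig : ∀ b u, u < N → v ∈ cell b u → b ≠ d i → px (d i) (R (d i) i) < pos (L i) v := by
      rintro b u hu ⟨h1, h2, h3⟩ hb
      have hc : col b = i := col_unique hL.1 h1 hvi
      rw [hc] at h2
      have h4 := hdblk b (by rw [hc]; exact hb)
      rw [hc] at h4
      have h5 := hxy (d i) (R (d i) i) (by omega)
      have h6 := hyy (d i) (R (d i) i) (N - 1) (by omega) hN1
      have h7 := hxx b 0 u (by omega) hu
      omega
    have hsame : ∀ u, u < N → v ∈ cell (d i) u → R (d i) i < u →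
        px (d i) (R (d i) i) < pos (L i) v := by
      rintro u hu ⟨h1, h2, h3⟩ hlt
      rw [e1] at h2
      have := hxs (d i) _ _ hlt hu
      omega
    rcases hI a j v hv with h | h
    · by_cases hb : a = d i
      · subst hb
        apply hsame _ (by omega) h
        have := hR0 (d i) j (by rw [e1]) (by rw [e1]; exact hj)
        rwa [e1] at this
      · exact hbig a _ (by omega) h hb
    · by_cases hb : f a = d i
      · rw [hb] at h
        exact hsame _ (by omega) h (by omega)
      · exact hbig _ _ (by omega) h hb
  · intro i hi a j _ hj v hv hvi
    obtain ⟨e1, e2⟩ := hla i hi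
    have key : pos (L i) (x (f (pr (la i))) (R (pr (la i)) i + D + 1)) =
        px (la i) (R (pr (la i)) i + D + 1) := by rw [hpr, hpx, e1]
    show _ < pos (L i) (x (f (pr (la i))) (R (pr (la i)) i + D + 1))
    rw [key]
    have hrd := hR (pr (la i)) i
    have hra := hR a j
    have hbig : ∀ b u, u < N → v ∈ cell b u → b ≠ la i →
        pos (L i) v < px (la i) (R (pr (la i)) i + D + 1) := by
      rintro b u hu ⟨h1, h2, h3⟩ hb
      have hc : col b = i := col_unique hL.1 h1 hvi
      rw [hc] at h3
      have h4 := hlblk b (by rw [hc]; exact hb)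
      rw [hc] at h4
      have h6 := hyy b u (N - 1) (by omega) hN1
      have h7 := hxx (la i) 0 (R (pr (la i)) i + D + 1) (by omega) (by omega)
      omega
    have hsame : ∀ u, u < N → v ∈ cell (la i) u → u < R (pr (la i)) i + D + 1 →
        pos (L i) v < px (la i) (R (pr (la i)) i + D + 1) := by
      rintro u hu ⟨h1, h2, h3⟩ hlt
      rw [e1] at h3
      have := hyx (la i) _ _ hlt (by omega)
      omega
    rcases hI a j v hv with h | h
    · by_cases hb : a = la i
      · rw [hb] at h
        rw [hb] at hra
        exact hsame _ (by rw [← hb]; have := hR a j; omega) h (by omega)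
      · exact hbig a _ (by omega) h hb
    · by_cases hb : f a = la i
      · have e3 : pr (la i) = a := hfi (by rw [hpr, hb])
        have hc : col (f a) = i := by rw [hb, e1]
        have := hRl a j (by rw [hc, hb]) (by rw [hc]; exact hj)
        rw [hc] at this
        rw [hb] at h
        exact hsame _ (by omega) h (by rw [e3]; omega)
      · exact hbig _ _ (by omega) h hb
  · rintro v rfl
    have hi : ∃ a, col a = i0 := ⟨_, rfl⟩
    obtain ⟨e1, e2⟩ := hd i0 hi
    obtain ⟨k1, k2⟩ := hla i0 hi
    refine ⟨i0, hi, ?_, ?_, ?_⟩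
    · have := hx (d i0) D hDN
      rwa [e1] at this
    · have h1 := hxs (d i0) (R (d i0) i0) D (hR _ _) hDN
      rw [hpx, hpx, e1] at h1
      exact h1
    · have hrd := hR (pr (la i0)) i0
      have key : pos (L i0) (x (f (pr (la i0))) (R (pr (la i0)) i0 + D + 1)) =
        px (la i0) (R (pr (la i0)) i0 + D + 1) := by rw [hpr, hpx, k1]
      show _ < pos (L i0) (x (f (pr (la i0))) (R (pr (la i0)) i0 + D + 1))
      rw [key]
      have key2 : pos (L i0) (x (d i0) D) = px (d i0) D := by rw [hpx, e1]
      rw [key2]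
      by_cases hdl : d i0 = la i0
      · rw [hdl]; exact hxs _ _ _ (by omega) (by omega)
      · have h4 := hlblk (d i0) (by rw [e1]; exact hdl)
        rw [e1] at h4
        have h5 := hxy (d i0) D hDN
        have h6 := hyy (d i0) D (N - 1) (by omega) hN1
        have h7 := hxx (la i0) 0 (R (pr (la i0)) i0 + D + 1) (by omega) (by omega)
        omega
  · rintro v rfl a j _ hv
    have hr := hR a j
    rcases hI a j _ hv with h | h
    · have := hcell _ _ _ _ _ hDN (by omega) (hxcell (d i0) D hDN) h
      omega
    · have := hcell _ _ _ _ _ hDN (by omega) (hxcell (d i0) D hDN) h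
      omega
  · intro a i _ v hv
    rcases hI a i v hv with h | h
    · exact Or.inl (Set.mem_iUnion.2 ⟨_, h.1⟩)
    · exact Or.inl (Set.mem_iUnion.2 ⟨_, h.1⟩)
  · simp

theorem split_blocks {S : Type} (lo hi : S → ℕ → ℕ) (z N : ℕ) (hN : 0 < N)
    (hlo : ∀ a, ∀ u v, u ≤ v → v < z → lo a u ≤ lo a v)
    (hhl : ∀ a, ∀ u v, u < v → v < z → hi a u < lo a v) :
    ∀ (m : ℕ) (T : Finset S), T.card = m → ∀ q, q + m * N ≤ z →
      ∃ o : S → ℕ, (∀ a ∈ T, q ≤ o a ∧ o a + N ≤ q + m * N) ∧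
        ∀ a ∈ T, ∀ b ∈ T, a ≠ b →
          hi a (o a + (N - 1)) < lo b (o b) ∨ hi b (o b + (N - 1)) < lo a (o a) := by
  intro m
  induction m with
  | zero =>
    intro T hT q _
    rw [Finset.card_eq_zero] at hT
    subst hT
    exact ⟨fun _ => 0, by simp, by simp⟩
  | succ m ih =>
    intro T hT q hq
    rw [Nat.succ_mul] at hq
    have hTne : T.Nonempty := by rw [← Finset.card_pos]; omega
    obtain ⟨a0, ha0, hmin⟩ := Finset.exists_min_image T (fun a => hi a (q + (N - 1))) hTne
    have hc : (T.erase a0).card = m := by rw [Finset.card_erase_of_mem ha0]; omega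
    obtain ⟨o, o1, o2⟩ := ih (T.erase a0) hc (q + N) (by omega)
    have e0 : Function.update o a0 q a0 = q := Function.update_self _ _ _
    have e1 : ∀ b, b ≠ a0 → Function.update o a0 q b = o b := fun b hb =>
      Function.update_of_ne hb _ _
    have hfirst : ∀ b ∈ T, b ≠ a0 → hi a0 (q + (N - 1)) < lo b (o b) := by
      intro b hb hne
      obtain ⟨p1, p2⟩ := o1 b (Finset.mem_erase.2 ⟨hne, hb⟩)
      have h1 := hmin b hb
      have h2 := hhl b (q + (N - 1)) (o b) (by omega) (by omega)
      omega
    refine ⟨Function.update o a0 q, ?_, ?_⟩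
    · intro a ha
      rw [Nat.succ_mul]
      by_cases h : a = a0
      · rw [h, e0]; omega
      · rw [e1 a h]
        have := o1 a (Finset.mem_erase.2 ⟨h, ha⟩)
        omega
    · intro a ha b hb hab
      by_cases h : a = a0
      · have h' : b ≠ a0 := fun hh => hab (h.trans hh.symm)
        rw [e1 b h', h, e0]
        exact Or.inl (hfirst b hb h')
      · by_cases h' : b = a0
        · rw [e1 a h, h', e0]
          exact Or.inr (hfirst a ha h)
        · rw [e1 a h, e1 b h']
          exact o2 a (Finset.mem_erase.2 ⟨h, ha⟩) b (Finset.mem_erase.2 ⟨h', hb⟩) hab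

theorem z_bound (k c m : ℕ) (hm : m + 1 ≤ c) :
    m * (2 * (k ^ 2 + k + 1 + k) + 1) ≤ zOf k c := by
  unfold zOf
  rcases Nat.eq_zero_or_pos m with h0 | hpos
  · subst h0; simp
  obtain ⟨e, rfl⟩ : ∃ e, c = m + 1 + e := ⟨c - (m + 1), by omega⟩
  obtain ⟨m', rfl⟩ : ∃ m', m = m' + 1 := ⟨m - 1, by omega⟩
  have h1 : (m' + 1) * (2 * (k ^ 2 + k + 1 + k) + 1) ≤
      (m' + 1 + 1) * ((m' + 1 + 1) * (k ^ 2 + k + 1) + k + 2) := by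
    have : 0 ≤ m' * m' * k := Nat.zero_le _
    have : 0 ≤ m' * k * k := Nat.zero_le _
    have : 0 ≤ m' * m' * (k * k) := Nat.zero_le _
    nlinarith [Nat.zero_le (m' * k), Nat.zero_le (m' * m'), Nat.zero_le (k * k)]
  refine h1.trans ?_
  have h2 : m' + 1 + 1 ≤ m' + 1 + 1 + e := by omega
  gcongr

theorem step3 [Fintype V] {k : ℕ} {sv tv : Fin k → V} {L : Fin k → Dpath G}
    (hL : IsMinimumLinkage L) {B : Set V} (c : ℕ)
    {S : Type} [Fintype S] [Nonempty S] (hSc : Fintype.card S ≤ c)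
    (f : S → S) (htr : ∀ a b, ∃ T, f^[T] a = b)
    (K : S → Set V) (hK : ∀ a, G.IsClique (K a))
    (hacc : ∀ a, CAcceptable sv tv L (K a) (B ∩ K a))
    (col : S → Fin k) (x y : S → ℕ → V) (z : ℕ) (hz : z = zOf k c)
    (hx : ∀ a, ∀ u < z, x a u ∈ (L (col a)).verts) (hxB : ∀ a, ∀ u < z, x a u ∈ B ∩ K a)
    (hy : ∀ a, ∀ u < z, y a u ∈ (L (col a)).verts) (hyB : ∀ a, ∀ u < z, y a u ∉ B)
    (hyK : ∀ a, ∀ u < z, y a u ∈ K (f a))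
    (hxy : ∀ a, ∀ u < z, pos (L (col a)) (x a u) < pos (L (col a)) (y a u))
    (hyx : ∀ a, ∀ u v, u < v → v < z → pos (L (col a)) (y a u) < pos (L (col a)) (x a v)) :
    False := by
  have hc1 : 0 < c := lt_of_lt_of_le Fintype.card_pos hSc
  have hz2 : 2 ≤ z := by
    rw [hz]; unfold zOf; nlinarith [Nat.zero_le (c * (k ^ 2 + k + 1))]
  -- not all colours agree
  have hcolne : ∀ i, ∃ a, col a ≠ i := by
    intro i
    by_contra hall
    push Not at hall
    obtain ⟨a, _, hmin⟩ := Finset.exists_min_image (Finset.univ : Finset S)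
      (fun a => pos (L i) (x a 1)) Finset.univ_nonempty
    have h1 := hmin (f a) (Finset.mem_univ _)
    have h2 := hyx a 0 1 (by omega) (by omega)
    rw [hall a] at h2
    have h3 : pos (L i) (x (f a) 1) < pos (L i) (y a 0) := by
      by_contra hlt
      have e1 := hy a 0 (by omega)
      have e2 := hx (f a) 1 (by omega)
      rw [hall] at e1 e2
      exact hyB a 0 (by omega) (init_of_cacc (hacc (f a)) e1 e2 (hyK a 0 (by omega))
        (hxB (f a) 1 (by omega)) (by omega)).1
    omega
  let D := k ^ 2 + k + 1 + k
  let N := 2 * D + 1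
  let lo : S → ℕ → ℕ := fun a u => pos (L (col a)) (x a u)
  let hi : S → ℕ → ℕ := fun a u => pos (L (col a)) (y a u)
  have hlo : ∀ a, ∀ u v, u ≤ v → v < z → lo a u ≤ lo a v := by
    intro a u v huv hv
    rcases Nat.eq_or_lt_of_le huv with rfl | h
    · exact le_rfl
    · exact ((hxy a u (by omega)).trans (hyx a u v h hv)).le
  have hsplit : ∀ i : Fin k, ∃ o : S → ℕ, (∀ a, col a = i → o a + N ≤ z) ∧
      ∀ a b, col a = i → col b = i → a ≠ b →
        hi a (o a + (N - 1)) < lo b (o b) ∨ hi b (o b + (N - 1)) < lo a (o a) := by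
    intro i
    let T : Finset S := Finset.univ.filter fun a => col a = i
    have hT : T.card + 1 ≤ c := by
      obtain ⟨a, ha⟩ := hcolne i
      have : T.card < Fintype.card S := by
        apply Finset.card_lt_univ_of_notMem (x := a)
        simp [T, ha]
      omega
    have hb := z_bound k c T.card hT
    obtain ⟨o, o1, o2⟩ := split_blocks lo hi z N (by omega) hlo (fun a => hyx a) T.card T rfl 0
      (by rw [hz]; simpa using hb)
    refine ⟨o, ?_, ?_⟩
    · intro a ha
      have := o1 a (by simp [T, ha])
      have hb' : T.card * N ≤ z := by rw [hz]; exact hb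
      omega
    · intro a b ha hb
      exact o2 a (by simp [T, ha]) b (by simp [T, hb])
  choose O O1 O2 using hsplit
  have hO : ∀ a, O (col a) a + N ≤ z := fun a => O1 (col a) a rfl
  refine step3b hL (B := B) f htr K hK hacc col (fun a u => x a (O (col a) a + u))
    (fun a u => y a (O (col a) a + u)) D N rfl rfl ?_ ?_ ?_ ?_ ?_
    (fun a u => lo a (O (col a) a + u)) (fun a u => hi a (O (col a) a + u))
    (fun _ _ => rfl) (fun _ _ => rfl) ?_ ?_ ?_
  · intro a u hu; exact hx a _ (by have := hO a; omega)
  · intro a u hu; exact hxB a _ (by have := hO a; omega)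
  · intro a u hu; exact hy a _ (by have := hO a; omega)
  · intro a u hu; exact hyB a _ (by have := hO a; omega)
  · intro a u hu; exact hyK a _ (by have := hO a; omega)
  · intro a u hu; exact hxy a _ (by have := hO a; omega)
  · intro a u v huv hv; exact hyx a _ _ (by omega) (by have := hO a; omega)
  · intro a b hab hc
    have := O2 (col a) a b rfl hc.symm hab
    simpa only [hc, Nat.add_zero] using this

theorem wiggle_bdd (P : Dpath G) (X Y : Set V) : BddAbove {m | HasAlt P X Y m} := by
  refine ⟨P.verts.length, ?_⟩
  rintro m ⟨l, h1, h2, _⟩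
  have := h1.length_le
  omega

theorem hasAlt_wiggle (P : Dpath G) (X Y : Set V) : HasAlt P X Y (wiggle P X Y) := by
  refine Nat.sSup_mem ?_ (wiggle_bdd P X Y)
  exact ⟨0, [], List.nil_sublist _, rfl, fun i h => by simp at h⟩

theorem wiggle_mono (P : Dpath G) {X Y X' Y' : Set V} (hX : X ⊆ X') (hY : Y ⊆ Y') :
    wiggle P X Y ≤ wiggle P X' Y' := by
  apply le_csSup (wiggle_bdd P X' Y')
  obtain ⟨l, h1, h2, h3⟩ := hasAlt_wiggle P X Y
  refine ⟨l, h1, h2, fun i h => ?_⟩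
  have := h3 i h
  split_ifs at this ⊢
  · exact hX this
  · exact hY this

/-- Extract the sequences from a large wiggle number. -/
theorem alt_seqs (P : Dpath G) (X Y : Set V) (z : ℕ) (h : z < wiggle P X Y) :
    ∃ b y : ℕ → V, (∀ u ≤ z, b u ∈ P.verts ∧ b u ∈ X ∧ y u ∈ P.verts ∧ y u ∈ Y ∧
      pos P (b u) < pos P (y u)) ∧ ∀ u v, u < v → v ≤ z → pos P (y u) < pos P (b v) := by
  obtain ⟨l, h1, h2, h3⟩ := hasAlt_wiggle P X Y
  obtain ⟨m1, m2⟩ := (sublist_iff P l).1 h1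
  rw [List.pairwise_iff_getElem] at m2
  have hpos : 0 < l.length := by omega
  let q : ℕ → V := fun u => if hu : u < l.length then l[u] else l[0]
  have hq : ∀ u (hu : u < l.length), q u = l[u] := fun u hu => dif_pos hu
  refine ⟨fun u => q (2 * u), fun u => q (2 * u + 1), ?_, ?_⟩
  · intro u hu
    have i1 : 2 * u < l.length := by omega
    have i2 : 2 * u + 1 < l.length := by omega
    simp only [hq _ i1, hq _ i2]
    refine ⟨m1 _ (List.getElem_mem _), ?_, m1 _ (List.getElem_mem _), ?_, m2 _ _ i1 i2 (by omega)⟩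
    · have := h3 _ i1
      rw [if_pos (by omega)] at this
      exact this
    · have := h3 _ i2
      rw [if_neg (by omega)] at this
      exact this
  · intro u v huv hv
    have i1 : 2 * u + 1 < l.length := by omega
    have i2 : 2 * v < l.length := by omega
    simp only [hq _ i1, hq _ i2]
    exact m2 _ _ i1 i2 (by omega)

theorem final [Fintype V] {k c : ℕ}
    (sv tv : Fin k → V)
    (C : Fin c → Set V) (hpart : G.IsCliquePartition C)
    (L : Fin k → Dpath G) (hL : IsMinimumLinkageFor L sv tv)
    (B : Set V) (hBL : B ⊆ linkSupport L)
    (hacc : Acceptable sv tv L C (zOf k c) B)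
    (hne : B ≠ linkSupport L \ Set.range tv) :
    ∃ v ∈ linkSupport L \ (B ∪ Set.range tv),
      Acceptable sv tv L C (zOf k c) (insert v B) := by
  by_contra hcon
  obtain ⟨ha1, ha2, ha3, ha4⟩ := hacc
  have hlast : ∀ i, (L i).last = tv i := fun i => (hL.1.2 i).2
  have huniq : ∀ v a a', v ∈ C a → v ∈ C a' → a = a' := fun v a a' h h' =>
    (hpart.2 v).unique h h'
  let U : Set (Fin c) := {a | ∃ v ∈ C a, v ∈ linkSupport L ∧ v ∉ B ∧ v ∉ Set.range tv}
  have hUne : U.Nonempty := by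
    by_contra hU
    apply hne
    apply Set.Subset.antisymm
    · intro v hv
      refine ⟨hBL hv, ?_⟩
      rintro ⟨i, rfl⟩
      exact ha2 i hv
    · rintro v ⟨h1, h2⟩
      by_contra h3
      obtain ⟨a, ha, _⟩ := hpart.2 v
      exact hU ⟨a, v, ha, h1, h3, h2⟩
  have hmain : ∀ a : U, ∃ (a' : U) (i : Fin k) (x y : ℕ → V),
      (∀ u < zOf k c, x u ∈ (L i).verts) ∧ (∀ u < zOf k c, x u ∈ B ∩ C a) ∧
      (∀ u < zOf k c, y u ∈ (L i).verts) ∧ (∀ u < zOf k c, y u ∉ B) ∧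
      (∀ u < zOf k c, y u ∈ C a') ∧
      (∀ u < zOf k c, pos (L i) (x u) < pos (L i) (y u)) ∧
      (∀ u v, u < v → v < zOf k c → pos (L i) (y u) < pos (L i) (x v)) := by
    rintro ⟨a, w, w1, w2, w3, w4⟩
    obtain ⟨v, v1, v2, v3, v4, v5⟩ := step1 hL (hpart.1 a) (ha3 a)
      ⟨w, w1, w2, fun h => w3 h.1, w4⟩
    have hvB : v ∉ B := fun h => v3 ⟨h, v1⟩
    have hins : insert v B ∩ C a = insert v (B ∩ C a) := by
      ext u; simp only [Set.mem_inter_iff, Set.mem_insert_iff]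
      constructor
      · tauto
      · rintro (rfl | h)
        · exact ⟨Or.inl rfl, v1⟩
        · exact ⟨Or.inr h.1, h.2⟩
    have hins' : ∀ a', a' ≠ a → insert v B ∩ C a' = B ∩ C a' := by
      intro a' hne'
      ext u; simp only [Set.mem_inter_iff, Set.mem_insert_iff]
      constructor
      · rintro ⟨rfl | h, h'⟩
        · exact absurd (huniq _ _ _ h' v1) hne'
        · exact ⟨h, h'⟩
      · tauto
    have hbad : ∃ a' b', a' ≠ b' ∧ ∃ i,
        zOf k c < wiggle (L i) (insert v B ∩ C b') ((insert v B)ᶜ ∩ C a') := by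
      by_contra hno
      push Not at hno
      refine hcon ⟨v, ⟨v2, ?_⟩, fun i => Or.inr (ha1 i), ?_, ?_, hno⟩
      · rintro (h | h)
        · exact hvB h
        · exact v4 h
      · rintro i (h | h)
        · exact v4 ⟨i, h⟩
        · exact ha2 i h
      · intro a'
        by_cases h : a' = a
        · subst h; rw [hins]; exact v5
        · rw [hins' a' h]; exact ha3 a'
    obtain ⟨a', b', hab, i, hi⟩ := hbad
    have hcsub : (insert v B)ᶜ ∩ C a' ⊆ Bᶜ ∩ C a' := fun u hu =>
      ⟨fun h => hu.1 (Or.inr h), hu.2⟩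
    have hb : b' = a := by
      by_contra h
      rw [hins' b' h] at hi
      have := wiggle_mono (L i) (subset_refl (B ∩ C b')) hcsub
      have := ha4 a' b' hab i
      omega
    subst hb
    obtain ⟨x, y, q1, q2⟩ := alt_seqs _ _ _ _ hi
    have hz : 1 ≤ zOf k c := by
      unfold zOf
      have := b'.pos
      nlinarith [Nat.zero_le (c * (k ^ 2 + k + 1))]
    have hxx : ∀ u < zOf k c, pos (L i) (x u) < pos (L i) (x (u + 1)) := fun u hu =>
      (q1 u hu.le).2.2.2.2.trans (q2 u (u + 1) (by omega) (by omega))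
    have ha'U : a' ∈ U := by
      obtain ⟨_, _, y1, y2, _⟩ := q1 0 (by omega)
      refine ⟨y 0, y2.2, Set.mem_iUnion.2 ⟨i, y1⟩, fun h => y2.1 (Or.inr h), ?_⟩
      rintro ⟨j, hj⟩
      have hm : tv j ∈ (L j).verts := by rw [← hlast]; exact last_mem _
      have hij : i = j := col_unique hL.2.1 (hj ▸ y1) hm
      subst hij
      have e1 := q2 0 1 (by omega) hz
      have e2 := pos_le_last (q1 1 hz).1
      rw [hlast, hj] at e2
      omega
    refine ⟨⟨a', ha'U⟩, i, x, y, fun u hu => (q1 u hu.le).1, ?_, fun u hu => (q1 u hu.le).2.2.1,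
      fun u hu h => (q1 u hu.le).2.2.2.1.1 (Or.inr h), fun u hu => (q1 u hu.le).2.2.2.1.2,
      fun u hu => (q1 u hu.le).2.2.2.2, fun u w h h' => q2 u w h h'.le⟩
    intro u hu
    obtain ⟨m1, m2, -⟩ := q1 u hu.le
    obtain ⟨n1, n2, -⟩ := q1 (u + 1) hu
    refine ⟨?_, m2.2⟩
    rcases m2.1 with h | h
    · exfalso
      have hlt := hxx u hu
      rcases n2.1 with h' | h'
      · rw [h, h'] at hlt; omega
      · exact v3 (init_of_cacc (ha3 b') (h ▸ m1) n1 v1 ⟨h', n2.2⟩ (h ▸ hlt.le))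
    · exact h
  choose F col x y c1 c2 c3 c4 c5 c6 c7 using hmain
  have hUn : Nonempty U := hUne.to_subtype
  obtain ⟨S, _, hS1, hS2, hS3⟩ := exists_cycle F Set.univ Set.univ_nonempty (fun _ _ => trivial)
  let F' : S → S := fun a => ⟨F a, hS2 a a.2⟩
  have hSn : Nonempty S := hS1.to_subtype
  refine step3 hL.2 (sv := sv) (tv := tv) (B := B) c ?_ F' ?_ (fun a : S => C a.1.1)
    (fun a => hpart.1 _) (fun a => ha3 _)
    (fun a => col a.1) (fun a => x a.1) (fun a => y a.1) _ rfl
    (fun a => c1 a.1) (fun a => c2 a.1) (fun a => c3 a.1) (fun a => c4 a.1) (fun a => c5 a.1)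
    (fun a => c6 a.1) (fun a => c7 a.1)
  · have := Fintype.card_le_of_injective (fun a : S => a.1.1)
      (fun a b h => Subtype.ext (Subtype.ext h))
    simpa using this
  · intro a b
    obtain ⟨T, hT⟩ := hS3 a a.2 b b.2
    refine ⟨T, Subtype.ext ?_⟩
    rw [iterate_sub F S F' (fun _ => rfl), hT]

end AA

/-- Theorem 3.3: if `B ⊆ V(L)` is acceptable and `B ≠ V(L) ∖ {t 1,…,t k}`, then some
vertex of `V(L) ∖ (B ∪ {t 1,…,t k})` can be added keeping acceptability. -/
theorem acceptable_augment {V : Type} [Fintype V] {k c : ℕ} (hk : 1 ≤ k) (hc : 1 ≤ c)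
    (G : Dgraph V) (sv tv : Fin k → V) (hinst : IsInstance sv tv)
    (C : Fin c → Set V) (hpart : G.IsCliquePartition C)
    (L : Fin k → Dpath G) (hL : IsMinimumLinkageFor L sv tv)
    (B : Set V) (hBL : B ⊆ linkSupport L)
    (hacc : Acceptable sv tv L C (zOf k c) B)
    (hne : B ≠ linkSupport L \ Set.range tv) :
    ∃ v ∈ linkSupport L \ (B ∪ Set.range tv),
      Acceptable sv tv L C (zOf k c) (insert v B) := by
  exact AA.final sv tv C hpart L hL B hBL hacc hne
end
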